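/- Let γ ∈ SF⁺ with q̄ = q̄(γ). For every integer k ≥ 3 there exists a constant C > 0 depending only on q̄ and k such that the k-th partial derivative in x of Φ_γ satisfies |∂ₓᵏΦ_γ(t,x)| ≤ C for all (t,x) ∈ [0,q̄] × ℝ, and the same constant works for every γ ∈ SF⁺ with q̄(γ) = q̄. (Proposition 4.1, Eq. (4.10).) -/

import Mathlib

open MeasureTheory ProbabilityTheory

/-- The standard Gaussian measure on `ℝ`. -/
noncomputable def stdGauss : Measure ℝ := gaussianReal 0 1

/-- The Gaussian tail function `𝒩(v) = P(Z ≥ v)`. -/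
noncomputable def gaussTail (v : ℝ) : ℝ := (stdGauss (Set.Ici v)).toReal

/-- A functional order parameter in `SF⁺`: a non-decreasing step function
`γ = Σ_{i=0}^n m_i · 1_{[q_i, q_{i+1})}` with `0 = q_0 < q_1 < ⋯ < q_{n+1} = 1` and
`0 = m_0 ≤ m_1 ≤ ⋯ ≤ m_n = 1`. -/
structure StepFn where
  n : ℕ
  q : ℕ → ℝ
  m : ℕ → ℝ
  q_zero : q 0 = 0
  q_last : q (n + 1) = 1
  q_lt : ∀ i ≤ n, q i < q (i + 1)
  m_zero : m 0 = 0
  m_last : m n = 1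
  m_mono : ∀ i < n, m i ≤ m (i + 1)

namespace StepFn

/-- The right end `q̄(γ) = q_n` of the support of `γ`. -/
noncomputable def qbar (γ : StepFn) : ℝ := γ.q γ.n

open Classical in
/-- `γ` as a function: `γ(s) = m_i` for `s ∈ [q_i, q_{i+1})`, and `0` outside `[0,1)`. -/
noncomputable def toFun (γ : StepFn) (s : ℝ) : ℝ :=
  if s ∈ Set.Ico (0 : ℝ) 1 then γ.m (Nat.findGreatest (fun i => γ.q i ≤ s) γ.n) else 0

end StepFn

/-- One Cole–Hopf step: given a boundary value `g` at the right end of an interval,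
spread `s` and parameter `m`, produce the value at distance `s` from the right end. -/
noncomputable def coleHopf (m s : ℝ) (g : ℝ → ℝ) (x : ℝ) : ℝ :=
  if 0 < m then (1 / m) * Real.log (∫ z, Real.exp (m * g (x + Real.sqrt s * z)) ∂stdGauss)
  else ∫ z, g (x + Real.sqrt s * z) ∂stdGauss

namespace StepFn

/-- `PhiAux γ κ j` is the solution `Φ_γ` on the interval `[q_{n-j}, q_{n-j+1})`,
built recursively downward from the terminal condition on `[q_n, 1)`. -/
noncomputable def PhiAux (γ : StepFn) (κ : ℝ) : ℕ → ℝ → ℝ → ℝ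
  | 0 => fun t x => Real.log (gaussTail ((κ - x) / Real.sqrt (1 - t)))
  | j + 1 => fun t x =>
      coleHopf (γ.m (γ.n - (j + 1))) (γ.q (γ.n - j) - t) (γ.PhiAux κ j (γ.q (γ.n - j))) x

open Classical in
/-- The solution `Φ_γ(t,x)` of the Parisi PDE for the step function `γ`:
for `t ∈ [q_i, q_{i+1})` it is given by `PhiAux γ κ (n - i)`. -/
noncomputable def Phi (γ : StepFn) (κ : ℝ) (t x : ℝ) : ℝ :=
  γ.PhiAux κ (γ.n - Nat.findGreatest (fun i => γ.q i ≤ t) γ.n) t x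

end StepFn

/-- Continuity together with an exponential growth bound. -/
def ExpGrowth (F : ℝ → ℝ) : Prop :=
  Continuous F ∧ ∃ K b, ∀ z, |F z| ≤ K * Real.exp (b * |z|)

/-- Exponential growth in the second variable, locally uniformly in the first. -/
def LocExpGrowth (F : ℝ → ℝ → ℝ) : Prop :=
  (∀ x, Continuous (F x)) ∧
    ∀ R, ∃ K b, ∀ x, |x| ≤ R → ∀ z, |F x z| ≤ K * Real.exp (b * |z|)

theorem LocExpGrowth.expGrowth {F : ℝ → ℝ → ℝ} (hF : LocExpGrowth F) (x : ℝ) :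
    ExpGrowth (F x) := by
  obtain ⟨K, b, h⟩ := hF.2 |x|
  exact ⟨hF.1 x, K, b, h x le_rfl⟩

theorem ExpGrowth.locExpGrowth {F : ℝ → ℝ} (hF : ExpGrowth F) :
    LocExpGrowth (fun _ => F) := by
  obtain ⟨K, b, h⟩ := hF.2
  exact ⟨fun _ => hF.1, fun _ => ⟨K, b, fun _ _ => h⟩⟩

theorem LocExpGrowth.mul {F G : ℝ → ℝ → ℝ} (hF : LocExpGrowth F) (hG : LocExpGrowth G) :
    LocExpGrowth (fun x z => F x z * G x z) := by
  refine ⟨fun x => (hF.1 x).mul (hG.1 x), fun R => ?_⟩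
  obtain ⟨K, b, h⟩ := hF.2 R
  obtain ⟨K', b', h'⟩ := hG.2 R
  refine ⟨K * K', b + b', fun x hx z => ?_⟩
  have := mul_le_mul (h x hx z) (h' x hx z) (abs_nonneg _) ((abs_nonneg _).trans (h x hx z))
  rw [abs_mul]
  refine this.trans (le_of_eq ?_)
  rw [add_mul, Real.exp_add]; ring

theorem LocExpGrowth.add {F G : ℝ → ℝ → ℝ} (hF : LocExpGrowth F) (hG : LocExpGrowth G) :
    LocExpGrowth (fun x z => F x z + G x z) := by
  refine ⟨fun x => (hF.1 x).add (hG.1 x), fun R => ?_⟩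
  obtain ⟨K, b, h⟩ := hF.2 R
  obtain ⟨K', b', h'⟩ := hG.2 R
  refine ⟨|K| + |K'|, max b b', fun x hx z => ?_⟩
  have e1 : Real.exp (b * |z|) ≤ Real.exp (max b b' * |z|) := by gcongr; exact le_max_left _ _
  have e2 : Real.exp (b' * |z|) ≤ Real.exp (max b b' * |z|) := by gcongr; exact le_max_right _ _
  calc |F x z + G x z| ≤ |F x z| + |G x z| := abs_add_le _ _
    _ ≤ |K| * Real.exp (b * |z|) + |K'| * Real.exp (b' * |z|) :=
      add_le_add ((h x hx z).trans (by gcongr; exact le_abs_self _))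
        ((h' x hx z).trans (by gcongr; exact le_abs_self _))
    _ ≤ |K| * Real.exp (max b b' * |z|) + |K'| * Real.exp (max b b' * |z|) := by gcongr
    _ = _ := by ring

theorem LocExpGrowth.of_continuous {c : ℝ → ℝ} (hc : Continuous c) :
    LocExpGrowth (fun x _ => c x) := by
  refine ⟨fun x => continuous_const, fun R => ?_⟩
  obtain ⟨C, hC⟩ := (isCompact_Icc (a := -R) (b := R)).exists_bound_of_continuousOn
    hc.continuousOn
  exact ⟨C, 0, fun x hx z => by simpa using hC x (abs_le.1 hx)⟩

theorem LocExpGrowth.sub {F G : ℝ → ℝ → ℝ} (hF : LocExpGrowth F) (hG : LocExpGrowth G) :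
    LocExpGrowth (fun x z => F x z - G x z) := by
  have := hF.add ((LocExpGrowth.of_continuous (continuous_const (y := (-1 : ℝ)))).mul hG)
  simpa [sub_eq_add_neg] using this

theorem LocExpGrowth.sum {ι : Type*} {F : ι → ℝ → ℝ → ℝ} (S : Finset ι)
    (hF : ∀ i ∈ S, LocExpGrowth (F i)) : LocExpGrowth (fun x z => ∑ i ∈ S, F i x z) := by
  classical
  induction S using Finset.induction_on with
  | empty => simpa using LocExpGrowth.of_continuous (continuous_const (y := (0 : ℝ)))
  | insert a S ha ih =>
    simp only [Finset.sum_insert ha]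
    exact (hF a (by simp)).add (ih fun i hi => hF i (by simp [hi]))

theorem LocExpGrowth.prod {ι : Type*} {F : ι → ℝ → ℝ → ℝ} (S : Finset ι)
    (hF : ∀ i ∈ S, LocExpGrowth (F i)) : LocExpGrowth (fun x z => ∏ i ∈ S, F i x z) := by
  classical
  induction S using Finset.induction_on with
  | empty => simpa using LocExpGrowth.of_continuous (continuous_const (y := (1 : ℝ)))
  | insert a S ha ih =>
    simp only [Finset.prod_insert ha]
    exact (hF a (by simp)).mul (ih fun i hi => hF i (by simp [hi]))

theorem ExpGrowth.mul {F G : ℝ → ℝ} (hF : ExpGrowth F) (hG : ExpGrowth G) :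
    ExpGrowth (fun z => F z * G z) :=
  (hF.locExpGrowth.mul hG.locExpGrowth).expGrowth 0

theorem ExpGrowth.add {F G : ℝ → ℝ} (hF : ExpGrowth F) (hG : ExpGrowth G) :
    ExpGrowth (fun z => F z + G z) :=
  (hF.locExpGrowth.add hG.locExpGrowth).expGrowth 0

theorem ExpGrowth.sub {F G : ℝ → ℝ} (hF : ExpGrowth F) (hG : ExpGrowth G) :
    ExpGrowth (fun z => F z - G z) :=
  (hF.locExpGrowth.sub hG.locExpGrowth).expGrowth 0

theorem expGrowth_const (c : ℝ) : ExpGrowth (fun _ => c) :=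
  ⟨continuous_const, |c|, 0, fun z => by simp⟩

theorem expGrowth_id : ExpGrowth (fun z => z) :=
  ⟨continuous_id, 1, 1, fun z => by
    rw [one_mul, one_mul]
    linarith [Real.add_one_le_exp |z|]⟩

theorem ExpGrowth.abs {F : ℝ → ℝ} (hF : ExpGrowth F) : ExpGrowth (fun z => |F z|) :=
  ⟨hF.1.abs, by simpa using hF.2⟩

theorem ExpGrowth.pow {F : ℝ → ℝ} (hF : ExpGrowth F) (n : ℕ) :
    ExpGrowth (fun z => F z ^ n) := by
  induction n with
  | zero => simpa using expGrowth_const 1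
  | succ n ih => simpa only [pow_succ] using ih.mul hF

theorem ExpGrowth.integrable {F : ℝ → ℝ} (hF : ExpGrowth F) {μ : Measure ℝ}
    (hμ : ∀ b, Integrable (fun z => Real.exp (b * |z|)) μ) : Integrable F μ := by
  obtain ⟨K, b, h⟩ := hF.2
  exact ((hμ b).const_mul K).mono' hF.1.aestronglyMeasurable (ae_of_all _ h)

/-- A function with exponential growth may be differentiated under the integral sign. -/
theorem LocExpGrowth.hasDerivAt_integral {F F' : ℝ → ℝ → ℝ} (hF : LocExpGrowth F)
    (hF' : LocExpGrowth F') (hd : ∀ x z, HasDerivAt (fun y => F y z) (F' x z) x)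
    {μ : Measure ℝ} (hμ : ∀ b, Integrable (fun z => Real.exp (b * |z|)) μ) (x : ℝ) :
    HasDerivAt (fun y => ∫ z, F y z ∂μ) (∫ z, F' x z ∂μ) x := by
  obtain ⟨K, b, h⟩ := hF'.2 (|x| + 1)
  refine (hasDerivAt_integral_of_dominated_loc_of_deriv_le (Metric.ball_mem_nhds x one_pos)
    (Filter.Eventually.of_forall fun y => (hF.1 y).aestronglyMeasurable)
    ((hF.expGrowth x).integrable hμ) (hF'.1 x).aestronglyMeasurable
    (bound := fun z => K * Real.exp (b * |z|)) (ae_of_all _ fun z y hy => h y ?_ z)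
    ((hμ b).const_mul K) (ae_of_all _ fun z y _ => hd y z)).2
  have := abs_sub_abs_le_abs_sub y x
  rw [Metric.mem_ball, Real.dist_eq] at hy
  linarith

/-- A family of positive weights `w x` on a measure space, together with a sequence of functions
`H a` such that `∂ₓ (H a) = H (a + 1)` and the logarithmic derivative of the weight is
`m * H 0`. -/
structure WeightFamily where
  μ : Measure ℝ
  m : ℝ
  w : ℝ → ℝ → ℝ
  H : ℕ → ℝ → ℝ → ℝ
  μ_ne : μ ≠ 0
  integrable_exp : ∀ b, Integrable (fun z => Real.exp (b * |z|)) μ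
  w_pos : ∀ x z, 0 < w x z
  w_growth : LocExpGrowth w
  H_growth : ∀ a, LocExpGrowth (H a)
  w_deriv : ∀ x z, HasDerivAt (fun y => w y z) (m * H 0 x z * w x z) x
  H_deriv : ∀ a x z, HasDerivAt (fun y => H a y z) (H (a + 1) x z) x

namespace WeightFamily

variable (T : WeightFamily)

/-- The tilted average at `x`. -/
noncomputable def avg (x : ℝ) (F : ℝ → ℝ) : ℝ :=
  (∫ z, F z * T.w x z ∂T.μ) / ∫ z, T.w x z ∂T.μ

theorem integrable_mul_w {F : ℝ → ℝ} (hF : ExpGrowth F) (x : ℝ) :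
    Integrable (fun z => F z * T.w x z) T.μ :=
  (hF.mul (T.w_growth.expGrowth x)).integrable T.integrable_exp

theorem integral_w_pos (x : ℝ) : 0 < ∫ z, T.w x z ∂T.μ := by
  rw [integral_pos_iff_support_of_nonneg (fun z => (T.w_pos x z).le)
    ((T.w_growth.expGrowth x).integrable T.integrable_exp)]
  have : Function.support (T.w x) = Set.univ := by
    ext z; simp [(T.w_pos x z).ne']
  rw [this, pos_iff_ne_zero]
  exact fun h => T.μ_ne (Measure.measure_univ_eq_zero.1 h)

theorem avg_add {F G : ℝ → ℝ} (hF : ExpGrowth F) (hG : ExpGrowth G) (x : ℝ) :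
    T.avg x (fun z => F z + G z) = T.avg x F + T.avg x G := by
  simp only [avg, add_mul]
  rw [integral_add (T.integrable_mul_w hF x) (T.integrable_mul_w hG x), add_div]

theorem avg_sub {F G : ℝ → ℝ} (hF : ExpGrowth F) (hG : ExpGrowth G) (x : ℝ) :
    T.avg x (fun z => F z - G z) = T.avg x F - T.avg x G := by
  simp only [avg, sub_mul]
  rw [integral_sub (T.integrable_mul_w hF x) (T.integrable_mul_w hG x), sub_div]

theorem avg_const_mul (c : ℝ) (F : ℝ → ℝ) (x : ℝ) :
    T.avg x (fun z => c * F z) = c * T.avg x F := by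
  simp only [avg, mul_assoc]
  rw [integral_const_mul, mul_div_assoc]

theorem avg_const (c x : ℝ) : T.avg x (fun _ => c) = c := by
  simp only [avg]
  rw [integral_const_mul, mul_div_assoc, div_self (T.integral_w_pos x).ne', mul_one]

theorem avg_sum {ι : Type*} (S : Finset ι) {F : ι → ℝ → ℝ} (hF : ∀ i ∈ S, ExpGrowth (F i))
    (x : ℝ) : T.avg x (fun z => ∑ i ∈ S, F i z) = ∑ i ∈ S, T.avg x (F i) := by
  simp only [avg, Finset.sum_mul]
  rw [integral_finsetSum _ fun i hi => T.integrable_mul_w (hF i hi) x, Finset.sum_div]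

theorem avg_mono_ae {F G : ℝ → ℝ} (hF : ExpGrowth F) (hG : ExpGrowth G) (x : ℝ)
    (h : ∀ᵐ z ∂T.μ, F z ≤ G z) : T.avg x F ≤ T.avg x G := by
  refine div_le_div_of_nonneg_right ?_ (T.integral_w_pos x).le
  refine integral_mono_ae (T.integrable_mul_w hF x) (T.integrable_mul_w hG x) ?_
  filter_upwards [h] with z hz
  exact mul_le_mul_of_nonneg_right hz (T.w_pos x z).le

theorem avg_mono {F G : ℝ → ℝ} (hF : ExpGrowth F) (hG : ExpGrowth G) (x : ℝ)
    (h : ∀ z, F z ≤ G z) : T.avg x F ≤ T.avg x G :=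
  T.avg_mono_ae hF hG x (ae_of_all _ h)

theorem abs_avg_le {F G : ℝ → ℝ} (hF : ExpGrowth F) (hG : ExpGrowth G) (x : ℝ)
    (h : ∀ z, |F z| ≤ G z) : |T.avg x F| ≤ T.avg x G := by
  have h1 := T.avg_mono hF hG x fun z => (le_abs_self _).trans (h z)
  have hn : ExpGrowth (fun z => -1 * F z) := (expGrowth_const (-1)).mul hF
  have h2 := T.avg_mono hn hG x fun z => by
    rw [neg_one_mul]; exact (neg_le_abs _).trans (h z)
  rw [avg_const_mul] at h2
  exact abs_le.2 ⟨by linarith, h1⟩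

theorem hasDerivAt_integral_w (x : ℝ) :
    HasDerivAt (fun y => ∫ z, T.w y z ∂T.μ)
      (T.m * T.avg x (T.H 0 x) * ∫ z, T.w x z ∂T.μ) x := by
  have hg : LocExpGrowth (fun x z => T.m * T.H 0 x z * T.w x z) :=
    ((LocExpGrowth.of_continuous continuous_const).mul (T.H_growth 0)).mul T.w_growth
  convert T.w_growth.hasDerivAt_integral hg T.w_deriv T.integrable_exp x using 1
  simp only [mul_assoc]
  rw [integral_const_mul, avg, div_mul_cancel₀ _ (T.integral_w_pos x).ne']

theorem hasDerivAt_avg {F F' : ℝ → ℝ → ℝ} (hF : LocExpGrowth F) (hF' : LocExpGrowth F')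
    (hd : ∀ x z, HasDerivAt (fun y => F y z) (F' x z) x) (x : ℝ) :
    HasDerivAt (fun y => T.avg y (F y))
      (T.avg x (F' x) + T.m * T.avg x (fun z => F x z * (T.H 0 x z - T.avg x (T.H 0 x)))) x := by
  have hm : LocExpGrowth (fun x z => T.m * T.H 0 x z) :=
    (LocExpGrowth.of_continuous continuous_const).mul (T.H_growth 0)
  have hnum := (hF.mul T.w_growth).hasDerivAt_integral
    ((hF'.mul T.w_growth).add (hF.mul (hm.mul T.w_growth)))
    (fun x z => (hd x z).mul (T.w_deriv x z)) T.integrable_exp x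
  have hZ := T.integral_w_pos x
  refine (hnum.div (T.hasDerivAt_integral_w x) hZ.ne').congr_deriv ?_
  have e1 : ∫ z, (F' x z * T.w x z + F x z * (T.m * T.H 0 x z * T.w x z)) ∂T.μ
      = (T.avg x (F' x) + T.m * T.avg x (fun z => F x z * T.H 0 x z)) *
        ∫ z, T.w x z ∂T.μ := by
    rw [integral_add (T.integrable_mul_w (hF'.expGrowth x) x)
      ((hF.mul (hm.mul T.w_growth)).expGrowth x |>.integrable T.integrable_exp), add_mul,
      ← avg_const_mul, avg, avg, div_mul_cancel₀ _ hZ.ne', div_mul_cancel₀ _ hZ.ne']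
    congr 2; ext z; ring
  have e2 : T.avg x (fun z => F x z * (T.H 0 x z - T.avg x (T.H 0 x)))
      = T.avg x (fun z => F x z * T.H 0 x z) - T.avg x (T.H 0 x) * T.avg x (F x) := by
    rw [← avg_const_mul, ← avg_sub _ ((hF.mul (T.H_growth 0)).expGrowth x)
      ((expGrowth_const _).mul (hF.expGrowth x))]
    congr 1; ext z; ring
  have e3 : ∫ z, F x z * T.w x z ∂T.μ = T.avg x (F x) * ∫ z, T.w x z ∂T.μ := by
    rw [avg, div_mul_cancel₀ _ hZ.ne']
  rw [e1, e2, e3]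
  field_simp
  ring

/-- The average of `H a`. -/
noncomputable def mean (a : ℕ) (x : ℝ) : ℝ := T.avg x (T.H a x)

/-- Joint central moment of the functions `H (f i)`, `i ∈ S`. -/
noncomputable def centralMoment (S : Finset ℕ) (f : ℕ → ℕ) (x : ℝ) : ℝ :=
  T.avg x (fun z => ∏ i ∈ S, (T.H (f i) x z - T.mean (f i) x))

/-- Covariance of `H a` and `H 0`. -/
noncomputable def cov (a : ℕ) (x : ℝ) : ℝ :=
  T.centralMoment {0, 1} (Function.update (fun _ => 0) 0 a) x

theorem cov_eq (a : ℕ) (x : ℝ) :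
    T.cov a x = T.avg x (fun z => (T.H a x z - T.mean a x) * (T.H 0 x z - T.mean 0 x)) := by
  simp [cov, centralMoment, Function.update]

theorem hasDerivAt_mean (a : ℕ) (x : ℝ) :
    HasDerivAt (T.mean a) (T.mean (a + 1) x + T.m * T.cov a x) x := by
  refine (T.hasDerivAt_avg (T.H_growth a) (T.H_growth (a + 1)) (T.H_deriv a) x).congr_deriv ?_
  have hc : ExpGrowth (fun z => T.H 0 x z - T.mean 0 x) :=
    ((T.H_growth 0).expGrowth x).sub (expGrowth_const _)
  have : T.cov a x = T.avg x (fun z => T.H a x z * (T.H 0 x z - T.mean 0 x)) -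
      T.mean a x * T.avg x (fun z => T.H 0 x z - T.mean 0 x) := by
    rw [cov_eq, ← avg_const_mul, ← avg_sub _ (((T.H_growth a).expGrowth x).mul hc)
      ((expGrowth_const _).mul hc)]
    congr 1; ext z; ring
  rw [this, avg_sub _ ((T.H_growth 0).expGrowth x) (expGrowth_const _), avg_const]
  simp [mean]

theorem continuous_mean (a : ℕ) : Continuous (T.mean a) :=
  continuous_iff_continuousAt.2 fun x => (T.hasDerivAt_mean a x).continuousAt

theorem locExpGrowth_sub_mean (a : ℕ) :
    LocExpGrowth (fun x z => T.H a x z - T.mean a x) :=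
  (T.H_growth a).sub (LocExpGrowth.of_continuous (T.continuous_mean a))

theorem centralMoment_singleton (i : ℕ) (f : ℕ → ℕ) (x : ℝ) :
    T.centralMoment {i} f x = 0 := by
  simp only [centralMoment, Finset.prod_singleton]
  rw [avg_sub _ ((T.H_growth _).expGrowth x) (expGrowth_const _), avg_const]
  simp [mean]

theorem continuous_cov (a : ℕ) : Continuous (T.cov a) := by
  refine continuous_iff_continuousAt.2 fun x => ?_
  have e : T.cov a = fun x =>
      T.avg x (fun z => T.H a x z * T.H 0 x z) - T.mean 0 x * T.mean a x := by
    ext x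
    have h := (T.locExpGrowth_sub_mean 0).expGrowth x
    have : T.cov a x = T.avg x (fun z => T.H a x z * T.H 0 x z - T.mean 0 x * T.H a x z -
        T.mean a x * (T.H 0 x z - T.mean 0 x)) := by
      rw [cov_eq]; congr 1; ext z; ring
    have ha := (T.H_growth a).expGrowth x
    have h0 := (T.H_growth 0).expGrowth x
    rw [this, avg_sub _ ((ha.mul h0).sub ((expGrowth_const _).mul ha)) ((expGrowth_const _).mul h),
      avg_sub _ (ha.mul h0) ((expGrowth_const _).mul ha), avg_const_mul, avg_const_mul,
      avg_sub _ h0 (expGrowth_const _), avg_const]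
    simp [mean]
  rw [e]
  refine ContinuousAt.sub ?_ ((T.continuous_mean 0).mul (T.continuous_mean a)).continuousAt
  exact (T.hasDerivAt_avg ((T.H_growth a).mul (T.H_growth 0))
    (((T.H_growth (a + 1)).mul (T.H_growth 0)).add ((T.H_growth a).mul (T.H_growth 1)))
    (fun x z => (T.H_deriv a x z).mul (T.H_deriv 0 x z)) x).continuousAt

theorem hasDerivAt_centralMoment {S : Finset ℕ} {n : ℕ} (hn : n ∉ S) (f : ℕ → ℕ) (x : ℝ) :
    HasDerivAt (T.centralMoment S f)
      (∑ i ∈ S, (T.centralMoment S (Function.update f i (f i + 1)) x -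
          T.m * (T.cov (f i) x * T.centralMoment (S.erase i) f x)) +
        T.m * T.centralMoment (insert n S) (Function.update f n 0) x) x := by
  set c : ℕ → ℝ → ℝ → ℝ := fun a x z => T.H a x z - T.mean a x with hc
  have gc : ∀ a, LocExpGrowth (c a) := T.locExpGrowth_sub_mean
  set c' : ℕ → ℝ → ℝ → ℝ := fun a x z => c (a + 1) x z - T.m * T.cov a x with hc'
  have gc' : ∀ a, LocExpGrowth (c' a) := fun a => (gc _).sub
    (LocExpGrowth.of_continuous (continuous_const.mul (T.continuous_cov a)))
  have dc : ∀ a x z, HasDerivAt (fun y => c a y z) (c' a x z) x := fun a x z =>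
    ((T.H_deriv a x z).sub (T.hasDerivAt_mean a x)).congr_deriv (by simp only [hc', hc]; ring)
  have key := T.hasDerivAt_avg (F := fun x z => ∏ i ∈ S, c (f i) x z)
    (F' := fun x z => ∑ i ∈ S, (∏ j ∈ S.erase i, c (f j) x z) * c' (f i) x z)
    (LocExpGrowth.prod S fun i _ => gc _)
    (LocExpGrowth.sum S fun i _ => (LocExpGrowth.prod _ fun j _ => gc _).mul (gc' _))
    (fun x z => HasDerivAt.fun_finsetProd fun i _ => dc (f i) x z) x
  refine key.congr_deriv ?_
  congr 1
  · have gp : ∀ i, ExpGrowth (fun z => ∏ j ∈ S.erase i, c (f j) x z) := fun i =>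
      (LocExpGrowth.prod _ fun j _ => gc _).expGrowth x
    rw [avg_sum _ _ fun i _ => (gp i).mul ((gc' _).expGrowth x)]
    refine Finset.sum_congr rfl fun i hi => ?_
    have e1 : T.centralMoment S (Function.update f i (f i + 1)) x =
        T.avg x (fun z => (∏ j ∈ S.erase i, c (f j) x z) * c (f i + 1) x z) := by
      unfold centralMoment
      congr 1; ext z
      rw [← Finset.prod_erase_mul _ _ hi]
      congr 1
      · refine Finset.prod_congr rfl fun j hj => ?_
        rw [Function.update_of_ne (Finset.ne_of_mem_erase hj)]
      · simp [hc]
    have e2 : T.centralMoment (S.erase i) f x =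
        T.avg x (fun z => ∏ j ∈ S.erase i, c (f j) x z) := rfl
    rw [e1, e2, ← mul_assoc, ← avg_const_mul, ← avg_sub _ ((gp i).mul ((gc _).expGrowth x))
      ((expGrowth_const _).mul (gp i))]
    congr 1; ext z; simp only [hc']; ring
  · congr 1
    unfold centralMoment
    congr 1; ext z
    rw [Finset.prod_insert hn, mul_comm]
    congr 1
    · simp [mean]
    · refine Finset.prod_congr rfl fun j hj => ?_
      rw [Function.update_of_ne (ne_of_mem_of_not_mem hj hn)]

end WeightFamily

/-- The derivatives of `f` up to order `j` exist and are bounded by `C`. -/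
def DerivBound : ℕ → ℝ → (ℝ → ℝ) → Prop
  | 0, C, f => ∀ x, |f x| ≤ C
  | j + 1, C, f => (∀ x, |f x| ≤ C) ∧ ∃ f', (∀ x, HasDerivAt f (f' x) x) ∧ DerivBound j C f'

namespace DerivBound

theorem abs_le {j : ℕ} {C : ℝ} {f : ℝ → ℝ} (h : DerivBound j C f) (x : ℝ) : |f x| ≤ C := by
  cases j with
  | zero => exact h x
  | succ j => exact h.1 x

theorem mono {j : ℕ} {C C' : ℝ} {f : ℝ → ℝ} (h : DerivBound j C f) (hC : C ≤ C') :
    DerivBound j C' f := by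
  induction j generalizing f with
  | zero => exact fun x => (h x).trans hC
  | succ j ih =>
    obtain ⟨h0, f', hd, hf'⟩ := h
    exact ⟨fun x => (h0 x).trans hC, f', hd, ih hf'⟩

theorem of_succ {j : ℕ} {C : ℝ} {f : ℝ → ℝ} (h : DerivBound (j + 1) C f) :
    DerivBound j C f := by
  induction j generalizing f with
  | zero => exact h.1
  | succ j ih =>
    obtain ⟨h0, f', hd, hf'⟩ := h
    exact ⟨h0, f', hd, ih hf'⟩

theorem zero (j : ℕ) {C : ℝ} (hC : 0 ≤ C) : DerivBound j C (fun _ => 0) := by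
  induction j with
  | zero => exact fun x => by simpa using hC
  | succ j ih => exact ⟨fun x => by simpa using hC, _, fun x => hasDerivAt_const x 0, ih⟩

theorem add {j : ℕ} {C D : ℝ} {f g : ℝ → ℝ} (hf : DerivBound j C f) (hg : DerivBound j D g) :
    DerivBound j (C + D) (fun x => f x + g x) := by
  induction j generalizing f g with
  | zero => exact fun x => (abs_add_le _ _).trans (add_le_add (hf x) (hg x))
  | succ j ih =>
    obtain ⟨h0, f', hd, hf'⟩ := hf
    obtain ⟨h0', g', hd', hg'⟩ := hg
    exact ⟨fun x => (abs_add_le _ _).trans (add_le_add (h0 x) (h0' x)), _,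
      fun x => (hd x).add (hd' x), ih hf' hg'⟩

theorem const_mul {j : ℕ} {C c : ℝ} {f : ℝ → ℝ} (hc : |c| ≤ 1) (hf : DerivBound j C f) :
    DerivBound j C (fun x => c * f x) := by
  have key : ∀ y : ℝ, |y| ≤ C → |c * y| ≤ C := fun y hy => by
    rw [abs_mul]
    nlinarith [abs_nonneg y, abs_nonneg c]
  induction j generalizing f with
  | zero => exact fun x => key _ (hf x)
  | succ j ih =>
    obtain ⟨h0, f', hd, hf'⟩ := hf
    exact ⟨fun x => key _ (h0 x), _, fun x => (hd x).const_mul c, ih hf'⟩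

theorem sub {j : ℕ} {C D : ℝ} {f g : ℝ → ℝ} (hf : DerivBound j C f) (hg : DerivBound j D g) :
    DerivBound j (C + D) (fun x => f x - g x) := by
  simpa [sub_eq_add_neg] using hf.add (hg.const_mul (c := -1) (by simp))

theorem mul {j : ℕ} {C D : ℝ} {f g : ℝ → ℝ} (hf : DerivBound j C f) (hg : DerivBound j D g) :
    DerivBound j (2 ^ j * (C * D)) (fun x => f x * g x) := by
  have hb : ∀ x, |f x * g x| ≤ C * D := fun x => by
    rw [abs_mul]
    exact mul_le_mul (hf.abs_le x) (hg.abs_le x) (abs_nonneg _)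
      ((abs_nonneg _).trans (hf.abs_le x))
  induction j generalizing f g with
  | zero => exact fun x => by simpa using hb x
  | succ j ih =>
    have hf0 := hf.of_succ
    have hg0 := hg.of_succ
    obtain ⟨h0, f', hd, hf'⟩ := hf
    obtain ⟨h0', g', hd', hg'⟩ := hg
    have hCD : 0 ≤ C * D := (abs_nonneg _).trans (hb 0)
    have hmul : ∀ {a b : ℝ}, |a| ≤ C → |b| ≤ D → |a * b| ≤ C * D := fun ha hb => by
      rw [abs_mul]; exact mul_le_mul ha hb (abs_nonneg _) ((abs_nonneg _).trans ha)
    refine ⟨fun x => (hb x).trans (le_mul_of_one_le_left hCD (one_le_pow₀ one_le_two)), _,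
      fun x => (hd x).mul (hd' x), ?_⟩
    refine ((ih hf' hg0 fun x => hmul (hf'.abs_le x) (h0' x)).add
      (ih hf0 hg' fun x => hmul (h0 x) (hg'.abs_le x))).mono (le_of_eq ?_)
    ring

theorem sum {j : ℕ} {C : ℝ} {ι : Type*} (S : Finset ι) {f : ι → ℝ → ℝ}
    (hf : ∀ i ∈ S, DerivBound j C (f i)) :
    DerivBound j (S.card * C) (fun x => ∑ i ∈ S, f i x) := by
  classical
  induction S using Finset.induction_on with
  | empty => simpa using DerivBound.zero j le_rfl
  | insert a S ha ih =>
    simp only [Finset.sum_insert ha, Finset.card_insert_of_notMem ha]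
    refine ((hf a (by simp)).add (ih fun i hi => hf i (by simp [hi]))).mono (le_of_eq ?_)
    push_cast; ring

end DerivBound

/-- The order of a joint central moment: `H a` counts as a derivative of order `a + 1`. -/
def momentOrder (S : Finset ℕ) (f : ℕ → ℕ) : ℕ := ∑ i ∈ S, (f i + 1)

theorem card_le_momentOrder (S : Finset ℕ) (f : ℕ → ℕ) : S.card ≤ momentOrder S f := by
  rw [Finset.card_eq_sum_ones]
  exact Finset.sum_le_sum fun i _ => by omega

theorem momentOrder_erase {S : Finset ℕ} {i : ℕ} (hi : i ∈ S) (f : ℕ → ℕ) :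
    momentOrder (S.erase i) f + (f i + 1) = momentOrder S f :=
  Finset.sum_erase_add _ _ hi

theorem momentOrder_insert {S : Finset ℕ} {n : ℕ} (hn : n ∉ S) (f : ℕ → ℕ) :
    momentOrder (insert n S) (Function.update f n 0) = momentOrder S f + 1 := by
  rw [momentOrder, Finset.sum_insert hn, add_comm]
  congr 1
  · exact Finset.sum_congr rfl fun j hj => by
      rw [Function.update_of_ne (ne_of_mem_of_not_mem hj hn)]
  · simp

theorem momentOrder_update {S : Finset ℕ} {i : ℕ} (hi : i ∈ S) (f : ℕ → ℕ) :
    momentOrder S (Function.update f i (f i + 1)) = momentOrder S f + 1 := by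
  rw [← momentOrder_erase hi, ← momentOrder_erase hi f]
  have : momentOrder (S.erase i) (Function.update f i (f i + 1)) =
      momentOrder (S.erase i) f :=
    Finset.sum_congr rfl fun j hj => by rw [Function.update_of_ne (Finset.ne_of_mem_erase hj)]
  rw [this]; simp; omega

theorem momentOrder_cov (a : ℕ) :
    momentOrder {0, 1} (Function.update (fun _ => 0) 0 a) = a + 2 := by
  simp [momentOrder]

namespace WeightFamily

theorem derivBound_centralMoment_succ (T : WeightFamily) (hm : |T.m| ≤ 1) {j : ℕ} {C D : ℝ}
    (hC : 0 ≤ C) {S : Finset ℕ} {f : ℕ → ℕ} {n : ℕ} (hn : n ∉ S)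
    (h0 : ∀ x, |T.centralMoment S f x| ≤ D)
    (h1 : ∀ i ∈ S, DerivBound j D (T.centralMoment S (Function.update f i (f i + 1))))
    (h2 : ∀ i ∈ S, DerivBound j C (T.cov (f i)))
    (h3 : ∀ i ∈ S, DerivBound j D (T.centralMoment (S.erase i) f))
    (h4 : DerivBound j D (T.centralMoment (insert n S) (Function.update f n 0))) :
    DerivBound (j + 1) ((S.card * (1 + 2 ^ j * C) + 1) * D) (T.centralMoment S f) := by
  have hD : 0 ≤ D := (abs_nonneg _).trans (h0 0)
  refine ⟨fun x => (h0 x).trans (le_mul_of_one_le_left hD ?_), _,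
    fun x => T.hasDerivAt_centralMoment hn f x, ?_⟩
  · have : 0 ≤ (S.card : ℝ) * (1 + 2 ^ j * C) := by positivity
    linarith
  · refine ((DerivBound.sum S fun i hi =>
      (h1 i hi).sub (((h2 i hi).mul (h3 i hi)).const_mul hm)).add
        (h4.const_mul hm)).mono (le_of_eq ?_)
    ring

/-- Bounds on joint central moments of order at most `k` give bounds on their derivatives. -/
theorem exists_derivBound_centralMoment (k : ℕ) {K : ℝ} (hK : 0 ≤ K) (j : ℕ) :
    ∃ C, 0 ≤ C ∧ ∀ (T : WeightFamily) (σ : ℝ), 0 ≤ σ → |T.m| ≤ 1 →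
      (∀ S f, momentOrder S f ≤ k → 2 ≤ S.card → ∀ x, |T.centralMoment S f x| ≤ K * σ) →
      (∀ S f, momentOrder S f < k → 2 ≤ S.card → ∀ x, |T.centralMoment S f x| ≤ K) →
      (∀ S f, S.Nonempty → momentOrder S f + j ≤ k →
        DerivBound j (C * σ) (T.centralMoment S f)) ∧
      (∀ S f, S.Nonempty → momentOrder S f + j < k →
        DerivBound j C (T.centralMoment S f)) := by
  have single : ∀ (T : WeightFamily) {S : Finset ℕ} (f : ℕ → ℕ), S.Nonempty → ¬ 2 ≤ S.card →
      T.centralMoment S f = fun _ => 0 := by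
    intro T S f hS hc
    have : S.card = 1 := by have := hS.card_pos; omega
    obtain ⟨i, rfl⟩ := Finset.card_eq_one.1 this
    exact funext fun x => T.centralMoment_singleton i f x
  induction j with
  | zero =>
    refine ⟨K, hK, fun T σ hσ hm h1 h2 => ⟨fun S f hS ho x => ?_, fun S f hS ho x => ?_⟩⟩
    · by_cases hc : 2 ≤ S.card
      · exact h1 S f ho hc x
      · rw [single T f hS hc]; simpa using mul_nonneg hK hσ
    · by_cases hc : 2 ≤ S.card
      · exact h2 S f ho hc x
      · rw [single T f hS hc]; simpa using hK
  | succ j ih =>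
    obtain ⟨C, hC, ih⟩ := ih
    refine ⟨(k * (1 + 2 ^ j * C) + 1) * C, by positivity, fun T σ hσ hm h1 h2 => ?_⟩
    obtain ⟨ih1, ih2⟩ := ih T σ hσ hm h1 h2
    have hcov : ∀ {S : Finset ℕ} {f : ℕ → ℕ} {i : ℕ}, momentOrder S f + (j + 1) ≤ k →
        2 ≤ S.card → i ∈ S → DerivBound j C (T.cov (f i)) := by
      intro S f i ho hc hi
      refine ih2 _ _ (by simp) ?_
      rw [momentOrder_cov]
      have e1 := momentOrder_erase hi f
      have e2 := card_le_momentOrder (S.erase i) f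
      rw [Finset.card_erase_of_mem hi] at e2
      omega
    have herase : ∀ {S : Finset ℕ} {i : ℕ}, 2 ≤ S.card → i ∈ S → (S.erase i).Nonempty := by
      intro S i hc hi
      rw [← Finset.card_pos, Finset.card_erase_of_mem hi]; omega
    have hle : ∀ {S : Finset ℕ} {f : ℕ → ℕ} {D : ℝ}, 0 ≤ D → momentOrder S f + (j + 1) ≤ k →
        (S.card * (1 + 2 ^ j * C) + 1) * (C * D) ≤ (k * (1 + 2 ^ j * C) + 1) * C * D := by
      intro S f D hD ho
      have : (S.card : ℝ) ≤ k := by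
        exact_mod_cast (card_le_momentOrder S f).trans (by omega)
      rw [mul_assoc _ C D]
      gcongr
    constructor
    · intro S f hS ho
      by_cases hc : 2 ≤ S.card
      · obtain ⟨n, hn⟩ := Infinite.exists_notMem_finset S
        refine (T.derivBound_centralMoment_succ hm hC hn
          (ih1 S f hS (by omega)).abs_le (fun i hi => ih1 _ _ hS ?_)
          (fun i hi => hcov ho hc hi) (fun i hi => ih1 _ _ (herase hc hi) ?_)
          (ih1 _ _ (by simp) ?_)).mono (hle hσ ho)
        · rw [momentOrder_update hi]; omega
        · have := momentOrder_erase hi f; omega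
        · rw [momentOrder_insert hn]; omega
      · rw [single T f hS hc]; exact DerivBound.zero _ (by positivity)
    · intro S f hS ho
      by_cases hc : 2 ≤ S.card
      · obtain ⟨n, hn⟩ := Infinite.exists_notMem_finset S
        refine (T.derivBound_centralMoment_succ hm hC hn
          (ih2 S f hS (by omega)).abs_le (fun i hi => ih2 _ _ hS ?_)
          (fun i hi => hcov ho.le hc hi) (fun i hi => ih2 _ _ (herase hc hi) ?_)
          (ih2 _ _ (by simp) ?_)).mono ?_
        · rw [momentOrder_update hi]; omega
        · have := momentOrder_erase hi f; omega
        · rw [momentOrder_insert hn]; omega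
        · simpa using hle (S := S) (f := f) zero_le_one ho.le
      · rw [single T f hS hc]; exact DerivBound.zero _ (by positivity)

/-- The derivatives of a function with derivative `mean 0` agree with `mean` up to an error
controlled by the joint central moments. -/
theorem exists_abs_iteratedDeriv_sub_mean_le (k : ℕ) {K : ℝ} (hK : 0 ≤ K) :
    ∃ C, 0 ≤ C ∧ ∀ (T : WeightFamily) (σ : ℝ), 0 ≤ σ → |T.m| ≤ 1 →
      (∀ S f, momentOrder S f ≤ k + 1 → 2 ≤ S.card →
        ∀ x, |T.centralMoment S f x| ≤ K * σ) →
      (∀ S f, momentOrder S f < k + 1 → 2 ≤ S.card → ∀ x, |T.centralMoment S f x| ≤ K) →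
      ∀ u : ℝ → ℝ, (∀ x, HasDerivAt u (T.mean 0 x) x) →
        (∀ a ≤ k, Differentiable ℝ (iteratedDeriv a u)) ∧
        ∀ x, |iteratedDeriv (k + 1) u x - T.mean k x| ≤ C * σ := by
  choose C hC hCb using exists_derivBound_centralMoment (k + 1) hK
  set B := ∑ j ∈ Finset.range (k + 1), C j with hB
  have hB0 : 0 ≤ B := Finset.sum_nonneg fun j _ => hC j
  have hCB : ∀ j ≤ k, C j ≤ B := fun j hj =>
    Finset.single_le_sum (fun j _ => hC j) (Finset.mem_range.2 (by omega))
  refine ⟨k * B, by positivity, fun T σ hσ hm h1 h2 u hu => ?_⟩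
  have key : ∀ a ≤ k, ∃ R, DerivBound (k - a) (a * B * σ) R ∧
      ∀ x, iteratedDeriv (a + 1) u x = T.mean a x + R x := by
    intro a
    induction a with
    | zero =>
      refine fun _ => ⟨fun _ => 0, DerivBound.zero _ (by simp), fun x => ?_⟩
      simp [(hu x).deriv]
    | succ a ih =>
      intro ha
      obtain ⟨R, hR, hRe⟩ := ih (by omega)
      obtain ⟨j, hj⟩ : ∃ j, k - a = j + 1 := ⟨k - a - 1, by omega⟩
      rw [hj] at hR
      obtain ⟨-, R', hd, hR'⟩ := hR
      have hcov : DerivBound j (B * σ) (T.cov a) :=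
        ((hCb j T σ hσ hm h1 h2).1 _ _ (by simp)
          (by rw [momentOrder_cov]; omega)).mono
            (mul_le_mul_of_nonneg_right (hCB j (by omega)) hσ)
      refine ⟨fun x => T.m * T.cov a x + R' x, ?_, fun x => ?_⟩
      · rw [show k - (a + 1) = j by omega]
        refine ((hcov.const_mul hm).add hR').mono (le_of_eq ?_)
        push_cast; ring
      · rw [iteratedDeriv_succ, funext hRe]
        rw [((T.hasDerivAt_mean a x).fun_add (hd x)).deriv]
        ring
  refine ⟨fun a ha => ?_, fun x => ?_⟩
  · cases a with
    | zero => rw [iteratedDeriv_zero]; exact fun x => (hu x).differentiableAt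
    | succ a =>
      obtain ⟨R, hR, hRe⟩ := key a (by omega)
      obtain ⟨j, hj⟩ : ∃ j, k - a = j + 1 := ⟨k - a - 1, by omega⟩
      rw [hj] at hR
      obtain ⟨-, R', hd, -⟩ := hR
      rw [funext hRe]
      exact fun x => ((T.hasDerivAt_mean a x).fun_add (hd x)).differentiableAt
  · obtain ⟨R, hR, hRe⟩ := key k le_rfl
    rw [hRe, add_sub_cancel_left]
    exact hR.abs_le x

end WeightFamily

theorem integrable_exp_abs_stdGauss (b : ℝ) :
    Integrable (fun z => Real.exp (b * |z|)) stdGauss :=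
  integrable_exp_mul_abs (integrable_exp_mul_gaussianReal b) (integrable_exp_mul_gaussianReal (-b))

theorem integral_stdGauss (F : ℝ → ℝ) :
    ∫ z, F z ∂stdGauss = ∫ z, gaussianPDFReal 0 1 z * F z := by
  rw [stdGauss, integral_gaussianReal_eq_integral_smul one_ne_zero]
  rfl

theorem setIntegral_stdGauss {s : Set ℝ} (hs : MeasurableSet s) (F : ℝ → ℝ) :
    ∫ z in s, F z ∂stdGauss = ∫ z in s, gaussianPDFReal 0 1 z * F z := by
  rw [← integral_indicator hs, integral_stdGauss, ← integral_indicator hs]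
  congr 1; ext z
  by_cases hz : z ∈ s <;> simp [hz]

theorem ExpGrowth.integrable_pdf_mul {F : ℝ → ℝ} (hF : ExpGrowth F) :
    Integrable (fun z => gaussianPDFReal 0 1 z * F z) := by
  have h := hF.integrable integrable_exp_abs_stdGauss
  rw [stdGauss, gaussianReal_of_var_ne_zero _ one_ne_zero,
    integrable_withDensity_iff_integrable_smul' (measurable_gaussianPDF 0 1)
      (ae_of_all _ fun z => by simp [gaussianPDF_def])] at h
  simpa [toReal_gaussianPDF] using h

theorem hasDerivAt_gaussianPDFReal (z : ℝ) :
    HasDerivAt (gaussianPDFReal 0 1) (-z * gaussianPDFReal 0 1 z) z := by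
  simp only [gaussianPDFReal_def]
  have h : HasDerivAt (fun y : ℝ => -(y - 0) ^ 2 / (2 * ((1 : NNReal) : ℝ))) (-z) z := by
    have := ((((hasDerivAt_id' z).sub_const 0).fun_pow 2).fun_neg.div_const
      (2 * ((1 : NNReal) : ℝ)))
    exact this.congr_deriv (by norm_num; ring)
  refine (h.exp.const_mul _).congr_deriv ?_
  ring

theorem hasDerivAt_pdf_mul {F F' : ℝ → ℝ} (hd : ∀ z, HasDerivAt F (F' z) z) (z : ℝ) :
    HasDerivAt (fun z => gaussianPDFReal 0 1 z * F z)
      (gaussianPDFReal 0 1 z * (F' z - z * F z)) z :=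
  ((hasDerivAt_gaussianPDFReal z).mul (hd z)).congr_deriv (by ring)

/-- Gaussian integration by parts. -/
theorem integral_stein {F F' : ℝ → ℝ} (hF : ExpGrowth F) (hF' : ExpGrowth F')
    (hd : ∀ z, HasDerivAt F (F' z) z) : ∫ z, (F' z - z * F z) ∂stdGauss = 0 := by
  rw [integral_stdGauss]
  exact integral_eq_zero_of_hasDerivAt_of_integrable (hasDerivAt_pdf_mul hd)
    (hF'.sub (expGrowth_id.mul hF)).integrable_pdf_mul hF.integrable_pdf_mul

/-- Gaussian integration by parts on a half-line. -/
theorem setIntegral_Ici_stein {F F' : ℝ → ℝ} (hF : ExpGrowth F) (hF' : ExpGrowth F')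
    (hd : ∀ z, HasDerivAt F (F' z) z) :
    ∫ z in Set.Ici 0, (F' z - z * F z) ∂stdGauss = -(gaussianPDFReal 0 1 0 * F 0) := by
  rw [setIntegral_stdGauss measurableSet_Ici, integral_Ici_eq_integral_Ioi]
  have hi := (hF'.sub (expGrowth_id.mul hF)).integrable_pdf_mul.integrableOn (s := Set.Ioi 0)
  rw [integral_Ioi_of_hasDerivAt_of_tendsto' (fun z _ => hasDerivAt_pdf_mul hd z) hi
    (tendsto_zero_of_hasDerivAt_of_integrableOn_Ioi (fun z _ => hasDerivAt_pdf_mul hd z) hi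
      hF.integrable_pdf_mul.integrableOn), zero_sub]

/-- The moment of order `2 * p` of a standard Gaussian variable. -/
def evenMoment : ℕ → ℝ
  | 0 => 1
  | p + 1 => (2 * p + 1) * evenMoment p

theorem evenMoment_nonneg (p : ℕ) : 0 ≤ evenMoment p := by
  induction p with
  | zero => exact zero_le_one
  | succ p ih => exact mul_nonneg (by positivity) ih

theorem expGrowth_sub_pow (a : ℝ) (n : ℕ) : ExpGrowth (fun z => (z - a) ^ n) :=
  (expGrowth_id.sub (expGrowth_const a)).pow n

namespace WeightFamily

variable (T : WeightFamily)

theorem avg_pow_le_evenMoment {x a : ℝ} {β : ℝ → ℝ} (hβ : ExpGrowth β)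
    (hae : ∀ᵐ z ∂T.μ, (z - a) * (β z - z) ≤ -(z - a) ^ 2)
    (hS : ∀ p : ℕ, 0 ≤ T.avg x
      (fun z => (2 * p + 1) * (z - a) ^ (2 * p) + (z - a) ^ (2 * p + 1) * (β z - z))) (p : ℕ) :
    T.avg x (fun z => (z - a) ^ (2 * p)) ≤ evenMoment p := by
  induction p with
  | zero => simp [evenMoment, avg_const]
  | succ p ih =>
    have e := expGrowth_sub_pow a
    have h1 : T.avg x (fun z => (2 * p + 1) * (z - a) ^ (2 * p) +
        (z - a) ^ (2 * p + 1) * (β z - z)) ≤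
        T.avg x (fun z => (2 * p + 1) * (z - a) ^ (2 * p) - (z - a) ^ (2 * (p + 1))) := by
      refine T.avg_mono_ae (((expGrowth_const _).mul (e _)).add ((e _).mul (hβ.sub expGrowth_id)))
        (((expGrowth_const _).mul (e _)).sub (e _)) x ?_
      filter_upwards [hae] with z hz
      have hp : 0 ≤ (z - a) ^ (2 * p) := (even_two_mul p).pow_nonneg _
      have := mul_le_mul_of_nonneg_left hz hp
      have e1 : (z - a) ^ (2 * p + 1) * (β z - z) =
        (z - a) ^ (2 * p) * ((z - a) * (β z - z)) := by ring
      have e2 : (z - a) ^ (2 * (p + 1)) = (z - a) ^ (2 * p) * (z - a) ^ 2 := by ring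
      rw [e1, e2]; linarith
    rw [avg_sub _ ((expGrowth_const _).mul (e _)) (e _), avg_const_mul] at h1
    rw [evenMoment]
    have : (2 * (p : ℝ) + 1) * T.avg x (fun z => (z - a) ^ (2 * p)) ≤
      (2 * p + 1) * evenMoment p := by gcongr
    linarith [hS p]

theorem abs_centralMoment_le {x a : ℝ}
    (hmom : ∀ p : ℕ, T.avg x (fun z => (z - a) ^ (2 * p)) ≤ evenMoment p)
    {S : Finset ℕ} {f : ℕ → ℕ} {L : ℕ → ℝ}
    (hL : ∀ i ∈ S, ∀ z, |T.H (f i) x z - T.H (f i) x a| ≤ L (f i) * |z - a|) :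
    |T.centralMoment S f x| ≤
      (∏ i ∈ S, L (f i)) * (4 ^ S.card * (evenMoment S.card + 1)) := by
  have ga : ExpGrowth (fun z => |z - a|) := (expGrowth_id.sub (expGrowth_const a)).abs
  have gH : ∀ b, ExpGrowth (T.H b x) := fun b => (T.H_growth b).expGrowth x
  have hL0 : ∀ i ∈ S, 0 ≤ L (f i) := fun i hi => by
    have := (abs_nonneg _).trans (hL i hi (a + 1))
    simpa using this
  have h1 : T.avg x (fun z => |z - a|) ≤ 1 := by
    have h2 := hmom 1
    have h3 := T.avg_mono ga (G := fun z => (1 / 2) * ((z - a) ^ (2 * 1) + 1))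
      ((expGrowth_const _).mul ((expGrowth_sub_pow a _).add (expGrowth_const _))) x fun z => by
        have := sq_nonneg (|z - a| - 1)
        have := sq_abs (z - a)
        nlinarith
    rw [avg_const_mul, avg_add _ (expGrowth_sub_pow a _) (expGrowth_const _), avg_const] at h3
    simp only [evenMoment] at h2
    norm_num at h2 h3 ⊢
    linarith
  have hmean : ∀ i ∈ S, ∀ z, |T.H (f i) x z - T.mean (f i) x| ≤ L (f i) * (|z - a| + 1) := by
    intro i hi z
    have e : T.H (f i) x a - T.mean (f i) x =
        -T.avg x (fun z => T.H (f i) x z - T.H (f i) x a) := by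
      rw [avg_sub _ (gH _) (expGrowth_const _), avg_const, mean]; ring
    have h2 : |T.H (f i) x a - T.mean (f i) x| ≤ L (f i) := by
      rw [e, abs_neg]
      refine (T.abs_avg_le ((gH _).sub (expGrowth_const _)) ((expGrowth_const (L (f i))).mul ga) x
        (hL i hi)).trans ?_
      rw [avg_const_mul]
      exact mul_le_of_le_one_right (hL0 i hi) h1
    calc |T.H (f i) x z - T.mean (f i) x|
        ≤ |T.H (f i) x z - T.H (f i) x a| + |T.H (f i) x a - T.mean (f i) x| :=
          abs_sub_le _ _ _
      _ ≤ L (f i) * |z - a| + L (f i) := add_le_add (hL i hi z) h2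
      _ = _ := by ring
  have hpt : ∀ z, |∏ i ∈ S, (T.H (f i) x z - T.mean (f i) x)| ≤
      (∏ i ∈ S, L (f i)) * (4 ^ S.card * ((z - a) ^ (2 * S.card) + 1)) := by
    intro z
    rw [Finset.abs_prod]
    refine (Finset.prod_le_prod (fun i _ => abs_nonneg _) fun i hi => hmean i hi z).trans ?_
    rw [Finset.prod_mul_distrib, Finset.prod_const]
    refine mul_le_mul_of_nonneg_left ?_ (Finset.prod_nonneg hL0)
    have hz := abs_nonneg (z - a)
    calc (|z - a| + 1) ^ S.card ≤ (|z - a| + 1) ^ (2 * S.card) :=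
          pow_le_pow_right₀ (by linarith) (by omega)
      _ ≤ 2 ^ (2 * S.card - 1) * (|z - a| ^ (2 * S.card) + 1 ^ (2 * S.card)) :=
          add_pow_le hz zero_le_one _
      _ ≤ 2 ^ (2 * S.card) * (|z - a| ^ (2 * S.card) + 1 ^ (2 * S.card)) := by
          gcongr
          · norm_num
          · omega
      _ = 4 ^ S.card * ((z - a) ^ (2 * S.card) + 1) := by
          rw [pow_mul 2, one_pow, (even_two_mul _).pow_abs]; norm_num
  refine (T.abs_avg_le ((LocExpGrowth.prod S fun i _ => T.locExpGrowth_sub_mean _).expGrowth x)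
    ((expGrowth_const _).mul ((expGrowth_const _).mul
      ((expGrowth_sub_pow a _).add (expGrowth_const _)))) x hpt).trans ?_
  rw [avg_const_mul, avg_const_mul, avg_add _ (expGrowth_sub_pow a _) (expGrowth_const _),
    avg_const]
  refine mul_le_mul_of_nonneg_left ?_ (Finset.prod_nonneg hL0)
  gcongr
  exact hmom _

theorem cov_zero_nonneg (x : ℝ) : 0 ≤ T.cov 0 x := by
  rw [cov_eq, ← T.avg_const 0 x]
  have h := (T.locExpGrowth_sub_mean 0).expGrowth x
  exact T.avg_mono (expGrowth_const 0) (h.mul h) x fun z => mul_self_nonneg _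

theorem cov_zero_eq_sub (x c : ℝ) :
    T.cov 0 x = T.avg x (fun z => (T.H 0 x z - c) ^ 2) - (T.mean 0 x - c) ^ 2 := by
  have h := ((T.H_growth 0).expGrowth x).sub (expGrowth_const c)
  have e : T.cov 0 x = T.avg x (fun z => (T.H 0 x z - c) ^ 2 -
      (2 * (T.mean 0 x - c) * (T.H 0 x z - c) - (T.mean 0 x - c) ^ 2)) := by
    rw [cov_eq]; congr 1; ext z; ring
  rw [e, avg_sub _ (h.pow 2) (((expGrowth_const _).mul h).sub (expGrowth_const _)),
    avg_sub _ ((expGrowth_const _).mul h) (expGrowth_const _), avg_const_mul,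
    avg_sub _ ((T.H_growth 0).expGrowth x) (expGrowth_const _), avg_const, avg_const, ← mean]
  ring

end WeightFamily

theorem ExpGrowth.of_hasDerivAt {F F' : ℝ → ℝ} (hd : ∀ z, HasDerivAt F (F' z) z)
    (hF' : ExpGrowth F') : ExpGrowth F := by
  obtain ⟨K, b, h⟩ := hF'.2
  refine ⟨continuous_iff_continuousAt.2 fun z => (hd z).continuousAt, |F 0| + |K|, |b| + 1,
    fun z => ?_⟩
  have hz := abs_nonneg z
  have h1 := (convex_Icc (-|z|) |z|).norm_image_sub_le_of_norm_hasDerivWithin_le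
    (f := F) (f' := F') (C := |K| * Real.exp (|b| * |z|)) (x := 0) (y := z)
    (fun y _ => (hd y).hasDerivWithinAt)
    (fun y hy => (h y).trans (mul_le_mul (le_abs_self K) (Real.exp_le_exp.2
      (mul_le_mul (le_abs_self b) (abs_le.2 hy) (abs_nonneg y) (abs_nonneg b)))
      (Real.exp_pos _).le (abs_nonneg K)))
    (Set.mem_Icc.2 ⟨neg_nonpos.2 hz, hz⟩) (Set.mem_Icc.2 (abs_le.1 le_rfl))
  rw [Real.norm_eq_abs, Real.norm_eq_abs, sub_zero] at h1
  have h2 : |F z| ≤ |F 0| + |F z - F 0| := by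
    have := abs_add_le (F 0) (F z - F 0)
    rwa [add_sub_cancel] at this
  have h3 : |z| ≤ Real.exp |z| := by linarith [Real.add_one_le_exp |z|]
  have h4 : 1 ≤ Real.exp ((|b| + 1) * |z|) := Real.one_le_exp (by positivity)
  have h5 : Real.exp (|b| * |z|) * |z| ≤ Real.exp ((|b| + 1) * |z|) := by
    rw [add_mul, one_mul, Real.exp_add]; gcongr
  nlinarith [abs_nonneg K, abs_nonneg (F 0)]

theorem ExpGrowth.comp_add_mul {F : ℝ → ℝ} (hF : ExpGrowth F) (r : ℝ) :
    LocExpGrowth (fun x z => F (x + r * z)) := by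
  obtain ⟨K, b, h⟩ := hF.2
  refine ⟨fun x => hF.1.comp (by fun_prop), fun R => ⟨|K| * Real.exp (|b| * R), |b| * |r|,
    fun x hx z => (h _).trans ?_⟩⟩
  rw [mul_assoc, ← Real.exp_add]
  have h1 : |x + r * z| ≤ R + |r| * |z| :=
    (abs_add_le _ _).trans (add_le_add hx (abs_mul _ _).le)
  have h2 : b * |x + r * z| ≤ |b| * R + |b| * |r| * |z| := by
    rw [mul_assoc, ← mul_add]
    exact mul_le_mul (le_abs_self b) h1 (abs_nonneg _) (abs_nonneg b)
  exact mul_le_mul (le_abs_self K) (Real.exp_le_exp.2 h2) (Real.exp_pos _).le (abs_nonneg K)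

/-- Gaussian integration by parts for a tilted average. -/
theorem WeightFamily.avg_stein (T : WeightFamily) (hT : T.μ = stdGauss) {x : ℝ} {β : ℝ → ℝ}
    (hβ : ExpGrowth β) (hw : ∀ z, HasDerivAt (T.w x) (β z * T.w x z) z) {F F' : ℝ → ℝ}
    (hF : ExpGrowth F) (hF' : ExpGrowth F') (hd : ∀ z, HasDerivAt F (F' z) z) :
    T.avg x (fun z => F' z + F z * (β z - z)) = 0 := by
  have gw := T.w_growth.expGrowth x
  have := integral_stein (hF.mul gw) ((hF'.mul gw).add (hF.mul (hβ.mul gw)))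
    fun z => (hd z).mul (hw z)
  rw [avg, hT, div_eq_zero_iff]
  left
  rw [← this]
  congr 1; ext z; ring

theorem exists_eq_of_antitone {β : ℝ → ℝ} (hβ : Continuous β) (h : Antitone β) :
    ∃ a, β a = a := by
  have hc : Continuous fun z => z - β z := continuous_id.sub hβ
  have h1 : (0 : ℝ) ∈ Set.Icc (-|β 0| - β (-|β 0|)) (|β 0| - β |β 0|) := by
    have h2 : β |β 0| ≤ β 0 := h (abs_nonneg _)
    have h3 : β 0 ≤ β (-|β 0|) := h (neg_nonpos.2 (abs_nonneg _))
    constructor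
    · linarith [neg_abs_le (β 0)]
    · linarith [le_abs_self (β 0)]
  obtain ⟨a, -, ha⟩ := intermediate_value_Icc
    ((neg_nonpos.2 (abs_nonneg (β 0))).trans (abs_nonneg _)) hc.continuousOn h1
  exact ⟨a, (sub_eq_zero.1 ha).symm⟩

theorem mul_sub_nonpos_of_antitone {β : ℝ → ℝ} (h : Antitone β) (a z : ℝ) :
    (z - a) * (β z - β a) ≤ 0 := by
  rcases le_total z a with hz | hz
  · exact mul_nonpos_of_nonpos_of_nonneg (sub_nonpos.2 hz) (sub_nonneg.2 (h hz))
  · exact mul_nonpos_of_nonneg_of_nonpos (sub_nonneg.2 hz) (sub_nonpos.2 (h hz))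

/-- Smooth nonpositive concave functions with second derivative at least `-c` and bounded
derivatives of every order at least three. -/
structure TameConcave (c : ℝ) (g : ℝ → ℝ) : Prop where
  differentiable : ∀ a, Differentiable ℝ (iteratedDeriv a g)
  nonpos : ∀ x, g x ≤ 0
  neg_le : ∀ x, -c ≤ iteratedDeriv 2 g x
  concave : ∀ x, iteratedDeriv 2 g x ≤ 0
  bounded : ∀ a, 3 ≤ a → ∃ A, ∀ x, |iteratedDeriv a g x| ≤ A

namespace TameConcave

variable {c : ℝ} {g : ℝ → ℝ}

theorem hasDerivAt (h : TameConcave c g) (a : ℕ) (y : ℝ) :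
    HasDerivAt (iteratedDeriv a g) (iteratedDeriv (a + 1) g y) y := by
  rw [iteratedDeriv_succ]; exact (h.differentiable a y).hasDerivAt

theorem abs_two_le (h : TameConcave c g) (x : ℝ) : |iteratedDeriv 2 g x| ≤ c :=
  abs_le.2 ⟨h.neg_le x, (h.concave x).trans (by linarith [h.neg_le x, h.concave x])⟩

theorem antitone (h : TameConcave c g) : Antitone (iteratedDeriv 1 g) :=
  antitone_of_deriv_nonpos (h.differentiable 1) fun x => by
    rw [← iteratedDeriv_succ]; exact h.concave x

theorem expGrowth (h : TameConcave c g) (a : ℕ) : ExpGrowth (iteratedDeriv a g) := by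
  have h2 : ExpGrowth (iteratedDeriv 2 g) :=
    ⟨(h.differentiable 2).continuous, c, 0, fun z => by simpa using h.abs_two_le z⟩
  have h1 := ExpGrowth.of_hasDerivAt (h.hasDerivAt 1) h2
  match a with
  | 0 => exact ExpGrowth.of_hasDerivAt (h.hasDerivAt 0) h1
  | 1 => exact h1
  | 2 => exact h2
  | a + 3 =>
    obtain ⟨A, hA⟩ := h.bounded (a + 3) (by omega)
    exact ⟨(h.differentiable _).continuous, A, 0, fun z => by simpa using hA z⟩

theorem hasDerivAt_comp (h : TameConcave c g) (a : ℕ) (r x z : ℝ) :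
    HasDerivAt (fun y => iteratedDeriv a g (y + r * z))
      (iteratedDeriv (a + 1) g (x + r * z)) x :=
  (h.hasDerivAt a (x + r * z)).comp_add_const x (r * z)

theorem hasDerivAt_comp_mul (h : TameConcave c g) (a : ℕ) (r x z : ℝ) :
    HasDerivAt (fun z => iteratedDeriv a g (x + r * z))
      (r * iteratedDeriv (a + 1) g (x + r * z)) z := by
  have h1 : HasDerivAt (fun z => x + r * z) r z := by
    simpa using ((hasDerivAt_id' z).const_mul r).const_add x
  exact ((h.hasDerivAt a (x + r * z)).comp z h1).congr_deriv (mul_comm _ _)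

theorem exp_le_one (h : TameConcave c g) {m : ℝ} (hm : 0 ≤ m) (y : ℝ) : Real.exp (m * g y) ≤ 1 :=
  Real.exp_le_one_iff.2 (mul_nonpos_of_nonneg_of_nonpos hm (h.nonpos y))

/-- The weights governing one Cole–Hopf step. -/
noncomputable def family (h : TameConcave c g) {m : ℝ} (hm : 0 ≤ m) (r : ℝ) : WeightFamily where
  μ := stdGauss
  m := m
  w x z := Real.exp (m * g (x + r * z))
  H a x z := iteratedDeriv (a + 1) g (x + r * z)
  μ_ne := by rw [stdGauss]; exact IsProbabilityMeasure.ne_zero _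
  integrable_exp := integrable_exp_abs_stdGauss
  w_pos x z := Real.exp_pos _
  w_growth := ⟨fun x => Real.continuous_exp.comp (continuous_const.mul
    ((h.differentiable 0).continuous.comp (by fun_prop))), fun R => ⟨1, 0, fun x _ z => by
      rw [abs_of_pos (Real.exp_pos _)]; simpa using h.exp_le_one hm (x + r * z)⟩⟩
  H_growth a := (h.expGrowth (a + 1)).comp_add_mul r
  w_deriv x z := by
    refine ((h.hasDerivAt_comp 0 r x z).const_mul m).exp.congr_deriv ?_
    rw [iteratedDeriv_zero]; ring
  H_deriv a x z := h.hasDerivAt_comp (a + 1) r x z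

theorem hasDerivAt_coleHopf (h : TameConcave c g) {m : ℝ} (hm : 0 ≤ m) (s x : ℝ) :
    HasDerivAt (coleHopf m s g) ((h.family hm (Real.sqrt s)).mean 0 x) x := by
  set T := h.family hm (Real.sqrt s) with hT
  rcases hm.eq_or_lt with rfl | hm'
  · have e : coleHopf 0 s g = fun x => ∫ z, g (x + Real.sqrt s * z) ∂stdGauss := by
      ext x; simp [coleHopf]
    rw [e]
    refine ((h.expGrowth 0).comp_add_mul (Real.sqrt s)).hasDerivAt_integral
      ((h.expGrowth 1).comp_add_mul (Real.sqrt s)) (fun x z => h.hasDerivAt_comp 0 _ x z)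
      integrable_exp_abs_stdGauss x |>.congr_deriv ?_
    simp [WeightFamily.mean, WeightFamily.avg, T, family, stdGauss]
  · have e : coleHopf m s g = fun x => (1 / m) * Real.log (∫ z, T.w x z ∂T.μ) := by
      ext x; rw [coleHopf, if_pos hm']; rfl
    rw [e]
    refine (((T.hasDerivAt_integral_w x).log (T.integral_w_pos x).ne').const_mul
      (1 / m)).congr_deriv ?_
    have hm0 : T.m = m := rfl
    rw [mul_div_cancel_right₀ _ (T.integral_w_pos x).ne', hm0, ← mul_assoc,
      one_div_mul_cancel hm'.ne', one_mul]
    rfl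

theorem coleHopf_nonpos (h : TameConcave c g) {m : ℝ} (hm : 0 ≤ m) (s x : ℝ) :
    coleHopf m s g x ≤ 0 := by
  rw [coleHopf]
  split_ifs
  · refine mul_nonpos_of_nonneg_of_nonpos (by positivity) (Real.log_nonpos
      (integral_nonneg fun z => (Real.exp_pos _).le) ?_)
    have : IsProbabilityMeasure stdGauss := by rw [stdGauss]; infer_instance
    have h1 := integral_mono (μ := stdGauss) (g := fun _ => (1 : ℝ))
      (((h.family hm (Real.sqrt s)).w_growth.expGrowth x).integrable integrable_exp_abs_stdGauss)
      (integrable_const _) fun z => h.exp_le_one hm (x + Real.sqrt s * z)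
    rw [integral_const, probReal_univ, one_smul] at h1
    exact h1
  · exact integral_nonpos fun z => h.nonpos _

section Tilt

variable {m : ℝ} (hm : 0 ≤ m) (r x : ℝ)

theorem expGrowth_tilt (h : TameConcave c g) :
    ExpGrowth (fun z => r * m * iteratedDeriv 1 g (x + r * z)) :=
  (expGrowth_const _).mul (((h.expGrowth 1).comp_add_mul r).expGrowth x)

theorem hasDerivAt_w (h : TameConcave c g) (z : ℝ) : HasDerivAt ((h.family hm r).w x)
    (r * m * iteratedDeriv 1 g (x + r * z) * (h.family hm r).w x z) z := by
  refine ((h.hasDerivAt_comp_mul 0 r x z).const_mul m).exp.congr_deriv ?_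
  simp only [family, iteratedDeriv_zero]; ring

theorem exists_moments_le (h : TameConcave c g) (hr : 0 ≤ r) : ∃ a, ∀ p : ℕ,
    (h.family hm r).avg x (fun z => (z - a) ^ (2 * p)) ≤ evenMoment p := by
  have hanti : Antitone fun z => r * m * iteratedDeriv 1 g (x + r * z) := fun y z hyz =>
    mul_le_mul_of_nonneg_left (h.antitone (by gcongr)) (mul_nonneg hr hm)
  have hβ := h.expGrowth_tilt (m := m) r x
  obtain ⟨a, ha⟩ := exists_eq_of_antitone hβ.1 hanti
  refine ⟨a, (h.family hm r).avg_pow_le_evenMoment hβ (ae_of_all _ fun z => ?_) fun p => ?_⟩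
  · have := mul_sub_nonpos_of_antitone hanti a z
    simp only [ha] at this
    nlinarith
  · refine ((h.family hm r).avg_stein rfl hβ (h.hasDerivAt_w hm r x)
      (F := fun z => (z - a) ^ (2 * p + 1)) (expGrowth_sub_pow a _)
      ((expGrowth_const _).mul (expGrowth_sub_pow a _)) fun z => ?_).ge
    refine (((hasDerivAt_id' z).sub_const a).fun_pow (2 * p + 1)).congr_deriv ?_
    simp

theorem abs_centralMoment_le (h : TameConcave c g) (hr : 0 ≤ r) {D : ℕ → ℝ}
    (hD : ∀ a x, |iteratedDeriv (a + 2) g x| ≤ D a) (S : Finset ℕ) (f : ℕ → ℕ) :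
    |(h.family hm r).centralMoment S f x| ≤
      r ^ S.card * (∏ i ∈ S, D (f i)) * (4 ^ S.card * (evenMoment S.card + 1)) := by
  obtain ⟨a, ha⟩ := h.exists_moments_le hm r x hr
  refine ((h.family hm r).abs_centralMoment_le ha (L := fun j => r * D j)
    fun i _ z => ?_).trans_eq ?_
  · have := convex_univ.norm_image_sub_le_of_norm_hasDerivWithin_le
      (f := fun z => iteratedDeriv (f i + 1) g (x + r * z)) (C := r * D (f i)) (x := a) (y := z)
      (fun y _ => (h.hasDerivAt_comp_mul (f i + 1) r x y).hasDerivWithinAt)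
      (fun y _ => by
        rw [norm_mul, Real.norm_of_nonneg hr]
        exact mul_le_mul_of_nonneg_left (hD _ _) hr) (Set.mem_univ _) (Set.mem_univ _)
    exact this
  · rw [Finset.prod_mul_distrib, Finset.prod_const]

theorem mean_one_add_nonpos (h : TameConcave c g) (hr : 0 < r) :
    (h.family hm r).mean 1 x + m * (h.family hm r).cov 0 x ≤ 0 := by
  set T := h.family hm r with hT
  have g0 := (T.H_growth 0).expGrowth x
  have g1 := (T.H_growth 1).expGrowth x
  have gz := expGrowth_id
  have hβ : ExpGrowth fun z => r * m * T.H 0 x z := h.expGrowth_tilt r x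
  have s1 := T.avg_stein rfl hβ (h.hasDerivAt_w hm r x) (expGrowth_const 1) (expGrowth_const 0)
    fun z => hasDerivAt_const z 1
  have s2 := T.avg_stein rfl hβ (h.hasDerivAt_w hm r x) g0 ((expGrowth_const r).mul g1)
    fun z => h.hasDerivAt_comp_mul 1 r x z
  simp only [zero_add, one_mul] at s1
  rw [T.avg_sub hβ gz, T.avg_const_mul] at s1
  rw [T.avg_add ((expGrowth_const r).mul g1) (g0.mul (hβ.sub gz)), T.avg_const_mul] at s2
  have e1 : T.avg x (fun z => T.H 0 x z * (r * m * T.H 0 x z - z)) =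
      r * m * T.avg x (fun z => T.H 0 x z ^ 2) - T.avg x (fun z => z * T.H 0 x z) := by
    rw [← T.avg_const_mul, ← T.avg_sub ((expGrowth_const _).mul (g0.pow 2)) (gz.mul g0)]
    congr 1; ext z; ring
  have e2 := T.cov_zero_eq_sub x 0
  simp only [sub_zero] at e2
  set zb := T.avg x (fun z => z) with hzb
  have e3 : T.avg x (fun z => (z - zb) * (T.H 0 x z - T.H 0 x zb)) =
      T.avg x (fun z => z * T.H 0 x z) - zb * T.mean 0 x := by
    have : T.avg x (fun z => (z - zb) * (T.H 0 x z - T.H 0 x zb)) =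
        T.avg x (fun z => z * T.H 0 x z - zb * T.H 0 x z - (T.H 0 x zb * z - T.H 0 x zb * zb)) := by
      congr 1; ext z; ring
    rw [this, T.avg_sub ((gz.mul g0).sub ((expGrowth_const _).mul g0))
      (((expGrowth_const _).mul gz).sub (expGrowth_const _)),
      T.avg_sub (gz.mul g0) ((expGrowth_const _).mul g0),
      T.avg_sub ((expGrowth_const _).mul gz) (expGrowth_const _), T.avg_const_mul,
      T.avg_const_mul, T.avg_const, ← hzb, WeightFamily.mean]
    ring
  have hanti : Antitone (T.H 0 x) := fun y z hyz => h.antitone (by gcongr)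
  have h3 : T.avg x (fun z => (z - zb) * (T.H 0 x z - T.H 0 x zb)) ≤ 0 := by
    rw [← T.avg_const 0 x]
    exact T.avg_mono ((gz.sub (expGrowth_const _)).mul (g0.sub (expGrowth_const _)))
      (expGrowth_const _) x fun z => mul_sub_nonpos_of_antitone hanti zb z
  have key : r * (T.mean 1 x + m * T.cov 0 x) =
      T.avg x (fun z => z * T.H 0 x z) - zb * T.mean 0 x := by
    rw [e2]
    rw [e1] at s2
    simp only [WeightFamily.mean] at s1 s2 ⊢
    linear_combination s2 - T.avg x (T.H 0 x) * s1
  exact nonpos_of_mul_nonpos_right (key.trans_le (e3.symm.trans_le h3)) hr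

end Tilt

end TameConcave

theorem prod_le_of_momentOrder_lt {k : ℕ} {B : ℝ} (hB : 1 ≤ B) {D : ℕ → ℝ}
    (hD0 : ∀ a, 0 ≤ D a) (hD : ∀ a, a + 2 ≤ k → D a ≤ B) {S : Finset ℕ} {f : ℕ → ℕ}
    (hS : momentOrder S f < k + 1) (h2 : 2 ≤ S.card) : ∏ i ∈ S, D (f i) ≤ B ^ (k + 1) := by
  have h1 : ∏ i ∈ S, D (f i) ≤ ∏ _i ∈ S, B := by
    refine Finset.prod_le_prod (fun i _ => hD0 _) fun i hi => hD _ ?_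
    have h3 := momentOrder_erase hi f
    have h4 := card_le_momentOrder (S.erase i) f
    rw [Finset.card_erase_of_mem hi] at h4
    omega
  rw [Finset.prod_const] at h1
  exact h1.trans (pow_le_pow_right₀ hB ((card_le_momentOrder S f).trans hS.le))

theorem prod_le_of_momentOrder_le {k : ℕ} (hk : 2 ≤ k) {A B : ℝ} (hA : 0 ≤ A) (hB : 1 ≤ B)
    {D : ℕ → ℝ} (hD0 : ∀ a, 0 ≤ D a) (hD : ∀ a, a + 2 ≤ k → D a ≤ B)
    (hDk : ∀ a, a + 2 = k + 1 → D a ≤ A) {S : Finset ℕ} {f : ℕ → ℕ}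
    (hS : momentOrder S f ≤ k + 1) (h2 : 2 ≤ S.card) :
    ∏ i ∈ S, D (f i) ≤ B ^ (k + 1) * (1 + A) := by
  have hle : ∀ i ∈ S, f i + 2 ≤ k + 1 := fun i hi => by
    have h3 := momentOrder_erase hi f
    have h4 := card_le_momentOrder (S.erase i) f
    rw [Finset.card_erase_of_mem hi] at h4
    omega
  have hpow : ∀ n ≤ k + 1, B ^ n ≤ B ^ (k + 1) := fun n hn => pow_le_pow_right₀ hB hn
  have hcard := (card_le_momentOrder S f).trans hS
  have hBk : 0 ≤ B ^ (k + 1) := by positivity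
  by_cases hex : ∃ i ∈ S, f i + 2 = k + 1
  · obtain ⟨i, hi, hik⟩ := hex
    rw [← Finset.mul_prod_erase _ _ hi]
    have h1 : ∏ j ∈ S.erase i, D (f j) ≤ ∏ _j ∈ S.erase i, B := by
      refine Finset.prod_le_prod (fun j _ => hD0 _) fun j hj => hD _ ?_
      have h3 := momentOrder_erase hi f
      have h4 := momentOrder_erase hj f
      omega
    rw [Finset.prod_const] at h1
    have h5 := h1.trans (hpow _ ((Finset.card_le_card (Finset.erase_subset i S)).trans hcard))
    have h6 := mul_le_mul (hDk _ hik) h5 (Finset.prod_nonneg fun j _ => hD0 _) hA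
    linarith
  · push Not at hex
    have h1 : ∏ i ∈ S, D (f i) ≤ ∏ _i ∈ S, B :=
      Finset.prod_le_prod (fun i _ => hD0 _) fun i hi => hD _ (by
        have := hle i hi; have := hex i hi; omega)
    rw [Finset.prod_const] at h1
    have := h1.trans (hpow _ hcard)
    nlinarith

theorem TameConcave.exists_abs_iteratedDeriv_coleHopf_le {k : ℕ} (hk : 2 ≤ k) {B : ℝ}
    (hB : 1 ≤ B) : ∃ C, 0 ≤ C ∧ ∀ (c : ℝ) (g : ℝ → ℝ), TameConcave c g → c ≤ B →
      (∀ a, 3 ≤ a → a ≤ k → ∀ x, |iteratedDeriv a g x| ≤ B) →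
      ∀ m s A : ℝ, 0 ≤ m → m ≤ 1 → 0 ≤ s → s ≤ 1 → (∀ x, |iteratedDeriv (k + 1) g x| ≤ A) →
      (∀ a ≤ k, Differentiable ℝ (iteratedDeriv a (coleHopf m s g))) ∧
        ∀ x, |iteratedDeriv (k + 1) (coleHopf m s g) x| ≤ A + C * (s * (1 + A)) := by
  set M : ℝ := ∑ n ∈ Finset.range (k + 2), 4 ^ n * (evenMoment n + 1) with hM
  have hterm : ∀ n : ℕ, 0 ≤ (4 : ℝ) ^ n * (evenMoment n + 1) := fun n =>
    mul_nonneg (by positivity) (by linarith [evenMoment_nonneg n])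
  have hM0 : 0 ≤ M := Finset.sum_nonneg fun n _ => hterm n
  have hMn : ∀ n, n ≤ k + 1 → (4 : ℝ) ^ n * (evenMoment n + 1) ≤ M := fun n hn =>
    Finset.single_le_sum (f := fun n : ℕ => (4 : ℝ) ^ n * (evenMoment n + 1))
      (fun n _ => hterm n) (Finset.mem_range.2 (by omega))
  have hBk : 0 ≤ B ^ (k + 1) := by positivity
  obtain ⟨C, hC, hmain⟩ := WeightFamily.exists_abs_iteratedDeriv_sub_mean_le k
    (mul_nonneg hBk hM0)
  refine ⟨C, hC, fun c g h hcB hgB m s A hm hm1 hs hs1 hA => ?_⟩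
  have hA0 : 0 ≤ A := (abs_nonneg _).trans (hA 0)
  have hbd : ∀ a, ∃ D, 0 ≤ D ∧ (∀ x, |iteratedDeriv (a + 2) g x| ≤ D) ∧
      (a + 2 ≤ k → D ≤ B) ∧ (a + 2 = k + 1 → D ≤ A) := by
    intro a
    rcases Nat.eq_zero_or_pos a with rfl | ha
    · exact ⟨c, (abs_nonneg _).trans (h.abs_two_le 0), h.abs_two_le, fun _ => hcB,
        fun _ => by omega⟩
    · rcases lt_trichotomy (a + 2) (k + 1) with hak | hak | hak
      · exact ⟨B, by linarith, hgB _ (by omega) (by omega), fun _ => le_rfl, fun _ => by omega⟩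
      · exact ⟨A, hA0, hak ▸ hA, fun _ => by omega, fun _ => le_rfl⟩
      · obtain ⟨D, hD⟩ := h.bounded (a + 2) (by omega)
        exact ⟨D, (abs_nonneg _).trans (hD 0), hD, fun _ => by omega, fun _ => by omega⟩
  choose D hD0 hD hDB hDA using hbd
  set r := Real.sqrt s
  have hr : 0 ≤ r := Real.sqrt_nonneg s
  have hr1 : r ≤ 1 := Real.sqrt_le_one.2 hs1
  have hrs : ∀ n, 2 ≤ n → r ^ n ≤ s := fun n hn =>
    (pow_le_pow_of_le_one hr hr1 hn).trans_eq (Real.sq_sqrt hs)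
  have hbound := fun x S f => h.abs_centralMoment_le hm r x hr hD S f
  obtain ⟨hdiff, hle⟩ := hmain (h.family hm r) (s * (1 + A)) (by positivity)
    (abs_le.2 ⟨by change -1 ≤ m; linarith, hm1⟩)
    (fun S f hS h2 x => by
      have h3 := prod_le_of_momentOrder_le hk hA0 hB hD0 hDB hDA hS h2
      have hP : 0 ≤ ∏ i ∈ S, D (f i) := Finset.prod_nonneg fun i _ => hD0 _
      calc _ ≤ _ := hbound x S f
        _ ≤ s * (B ^ (k + 1) * (1 + A)) * M := by
          gcongr
          · exact hterm _
          · exact hrs _ h2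
          · exact hMn _ ((card_le_momentOrder S f).trans hS)
        _ = _ := by ring)
    (fun S f hS h2 x => by
      have h3 := prod_le_of_momentOrder_lt hB hD0 hDB hS h2
      have hP : 0 ≤ ∏ i ∈ S, D (f i) := Finset.prod_nonneg fun i _ => hD0 _
      calc _ ≤ _ := hbound x S f
        _ ≤ 1 * B ^ (k + 1) * M := by
          gcongr
          · exact hterm _
          · exact pow_le_one₀ hr hr1
          · exact hMn _ ((card_le_momentOrder S f).trans hS.le)
        _ = _ := by ring)
    (coleHopf m s g) (h.hasDerivAt_coleHopf hm s)
  refine ⟨hdiff, fun x => ?_⟩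
  have hmean : |(h.family hm r).mean k x| ≤ A := by
    rw [← (h.family hm r).avg_const A x]
    exact (h.family hm r).abs_avg_le (((h.family hm r).H_growth k).expGrowth x)
      (expGrowth_const _) x fun z => hA _
  have := abs_sub_abs_le_abs_sub (iteratedDeriv (k + 1) (coleHopf m s g) x)
    ((h.family hm r).mean k x)
  linarith [hle x]

/-- Tame concave functions are preserved by a Cole–Hopf step. -/
theorem TameConcave.coleHopf {c : ℝ} {g : ℝ → ℝ} (h : TameConcave c g) {m s : ℝ}
    (hm : 0 ≤ m) (hm1 : m ≤ 1) (hs : 0 < s) (hs1 : s ≤ 1) : TameConcave c (coleHopf m s g) := by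
  choose! A hA using h.bounded
  have key : ∀ k, 2 ≤ k → (∀ a ≤ k, Differentiable ℝ (iteratedDeriv a (_root_.coleHopf m s g))) ∧
      ∃ A, ∀ x, |iteratedDeriv (k + 1) (_root_.coleHopf m s g) x| ≤ A := by
    intro k hk
    have hs0 : 0 ≤ ∑ a ∈ Finset.range (k + 1), |A a| := Finset.sum_nonneg fun a _ => abs_nonneg _
    obtain ⟨C, -, hmain⟩ := exists_abs_iteratedDeriv_coleHopf_le hk
      (B := 1 + |c| + ∑ a ∈ Finset.range (k + 1), |A a|) (by linarith [abs_nonneg c])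
    obtain ⟨h1, h2⟩ := hmain c g h (by linarith [le_abs_self c]) (fun a ha hak x => by
      have h3 := Finset.single_le_sum (f := fun a => |A a|) (fun a _ => abs_nonneg _)
        (Finset.mem_range.2 (Nat.lt_succ_of_le hak))
      have h4 := (hA a ha x).trans (le_abs_self _)
      linarith [abs_nonneg c]) m s (A (k + 1)) hm hm1 hs.le hs1 (hA (k + 1) (by omega))
    exact ⟨h1, _, h2⟩
  have hr : 0 < Real.sqrt s := Real.sqrt_pos.2 hs
  have hd1 : deriv (_root_.coleHopf m s g) = (h.family hm (Real.sqrt s)).mean 0 :=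
    funext fun x => (h.hasDerivAt_coleHopf hm s x).deriv
  have hd2 : ∀ x, iteratedDeriv 2 (_root_.coleHopf m s g) x =
      (h.family hm (Real.sqrt s)).mean 1 x + m * (h.family hm (Real.sqrt s)).cov 0 x := fun x => by
    rw [iteratedDeriv_succ, iteratedDeriv_one, hd1]
    exact ((h.family hm (Real.sqrt s)).hasDerivAt_mean 0 x).deriv
  refine ⟨fun a => (key (a + 2) (by omega)).1 a (by omega), h.coleHopf_nonpos hm s, fun x => ?_,
    fun x => ?_, fun a ha => ?_⟩
  · rw [hd2]
    have h1 := mul_nonneg hm ((h.family hm (Real.sqrt s)).cov_zero_nonneg x)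
    have h2 : -c ≤ (h.family hm (Real.sqrt s)).mean 1 x := by
      rw [← (h.family hm (Real.sqrt s)).avg_const (-c) x]
      exact (h.family hm (Real.sqrt s)).avg_mono (expGrowth_const _)
        (((h.family hm (Real.sqrt s)).H_growth 1).expGrowth x) x fun z => h.neg_le _
    linarith
  · rw [hd2]; exact h.mean_one_add_nonpos hm _ x hr
  · obtain ⟨b, rfl⟩ : ∃ b, a = b + 1 := ⟨a - 1, by omega⟩
    exact (key b (by omega)).2

/-- The weights representing a shifted Gaussian tail as an integral over a half-line. -/
noncomputable def tailFamily (τ κ : ℝ) : WeightFamily where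
  μ := stdGauss.restrict (Set.Ici 0)
  m := 1
  w x z := Real.exp (τ * (x - κ) * z - (τ * (x - κ)) ^ 2 / 2)
  H
    | 0 => fun x z => τ * (z - τ * (x - κ))
    | 1 => fun _ _ => -τ ^ 2
    | _ + 2 => fun _ _ => 0
  μ_ne h := by
    have := gaussianReal_absolutelyContinuous' 0 one_ne_zero (Measure.restrict_eq_zero.1 h)
    simp at this
  integrable_exp b := (integrable_exp_abs_stdGauss b).restrict
  w_pos x z := Real.exp_pos _
  w_growth := by
    refine ⟨fun x => by fun_prop, fun R => ⟨1, |τ| * (R + |κ|), fun x hx z => ?_⟩⟩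
    rw [abs_of_pos (Real.exp_pos _), one_mul, Real.exp_le_exp]
    have h1 : |x - κ| ≤ R + |κ| := (abs_sub _ _).trans (by gcongr)
    calc τ * (x - κ) * z - (τ * (x - κ)) ^ 2 / 2 ≤ τ * (x - κ) * z := by
          linarith [sq_nonneg (τ * (x - κ))]
      _ ≤ |τ * (x - κ) * z| := le_abs_self _
      _ = |τ| * |x - κ| * |z| := by rw [abs_mul, abs_mul]
      _ ≤ _ := by gcongr
  H_growth
    | 0 => (LocExpGrowth.of_continuous continuous_const).mul
        (expGrowth_id.locExpGrowth.sub (LocExpGrowth.of_continuous (by fun_prop)))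
    | 1 => LocExpGrowth.of_continuous continuous_const
    | _ + 2 => LocExpGrowth.of_continuous continuous_const
  w_deriv x z := by
    have h : HasDerivAt (fun x => τ * (x - κ)) τ x := by
      simpa using ((hasDerivAt_id' x).sub_const κ).const_mul τ
    refine ((h.mul_const z).fun_sub ((h.fun_pow 2).div_const 2)).exp.congr_deriv ?_
    simp only; ring
  H_deriv
    | 0, x, z => by
      have h : HasDerivAt (fun x => τ * (x - κ)) τ x := by
        simpa using ((hasDerivAt_id' x).sub_const κ).const_mul τ
      exact ((h.const_sub z).const_mul τ).congr_deriv (by ring)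
    | 1, x, z => hasDerivAt_const x _
    | _ + 2, x, z => hasDerivAt_const x _

/-- The logarithm of a shifted and scaled Gaussian tail. -/
noncomputable def logTail (τ κ x : ℝ) : ℝ := Real.log (gaussTail (-(τ * (x - κ))))

theorem gaussTail_neg (v : ℝ) :
    gaussTail (-v) = ∫ z in Set.Ici 0, Real.exp (v * z - v ^ 2 / 2) ∂stdGauss := by
  have h1 : gaussTail (-v) = ∫ _z in Set.Ici (-v), (1 : ℝ) ∂stdGauss := by
    rw [setIntegral_const, smul_eq_mul, mul_one]; rfl
  rw [h1, setIntegral_stdGauss measurableSet_Ici, setIntegral_stdGauss measurableSet_Ici,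
    ← integral_indicator measurableSet_Ici, ← integral_indicator measurableSet_Ici,
    ← integral_sub_right_eq_self _ v]
  congr 1; ext z
  by_cases hz : 0 ≤ z
  · rw [Set.indicator_of_mem (by simpa using hz), Set.indicator_of_mem (by simpa using hz)]
    simp only [gaussianPDFReal_def]
    rw [mul_one, mul_assoc _ (Real.exp _) (Real.exp _), ← Real.exp_add]
    congr 2
    simp only [NNReal.coe_one]; ring
  · rw [Set.indicator_of_notMem (by simpa using hz), Set.indicator_of_notMem (by simpa using hz)]

namespace tailFamily

variable (τ κ : ℝ)

theorem hasDerivAt_logTail (x : ℝ) : HasDerivAt (logTail τ κ) ((tailFamily τ κ).mean 0 x) x := by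
  set T := tailFamily τ κ with hT
  have e : logTail τ κ = fun x => Real.log (∫ z, T.w x z ∂T.μ) := by
    ext x; rw [logTail, gaussTail_neg]; rfl
  rw [e]
  refine ((T.hasDerivAt_integral_w x).log (T.integral_w_pos x).ne').congr_deriv ?_
  rw [mul_div_cancel_right₀ _ (T.integral_w_pos x).ne']
  exact one_mul _

theorem moments_le (x : ℝ) (p : ℕ) :
    (tailFamily τ κ).avg x (fun z => (z - max (τ * (x - κ)) 0) ^ (2 * p)) ≤ evenMoment p := by
  set v := τ * (x - κ) with hv
  set a := max v 0 with ha
  refine (tailFamily τ κ).avg_pow_le_evenMoment (expGrowth_const v) ?_ (fun p => ?_) p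
  · refine (ae_restrict_mem measurableSet_Ici).mono fun z (hz : 0 ≤ z) => ?_
    rcases le_total v 0 with h | h
    · rw [ha, max_eq_right h]; nlinarith
    · rw [ha, max_eq_left h]; nlinarith
  · have gw := (tailFamily τ κ).w_growth.expGrowth x
    have gp := expGrowth_sub_pow a
    have hw : ∀ z, HasDerivAt ((tailFamily τ κ).w x) (v * (tailFamily τ κ).w x z) z := fun z => by
      have h : HasDerivAt (fun z => v * z) v z := by simpa using (hasDerivAt_id' z).const_mul v
      exact (h.sub_const _).exp.congr_deriv (mul_comm _ _)
    have hd : ∀ z, HasDerivAt (fun z => (z - a) ^ (2 * p + 1))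
        ((2 * p + 1) * (z - a) ^ (2 * p)) z :=
      fun z => (((hasDerivAt_id' z).sub_const a).fun_pow (2 * p + 1)).congr_deriv (by simp)
    have := setIntegral_Ici_stein ((gp (2 * p + 1)).mul gw)
      ((((expGrowth_const (2 * p + 1)).mul (gp (2 * p))).mul gw).add
        ((gp (2 * p + 1)).mul ((expGrowth_const v).mul gw))) fun z => (hd z).mul (hw z)
    refine div_nonneg ?_ ((tailFamily τ κ).integral_w_pos x).le
    have e : ∫ z, ((2 * p + 1) * (z - a) ^ (2 * p) + (z - a) ^ (2 * p + 1) * (v - z)) *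
        (tailFamily τ κ).w x z ∂(tailFamily τ κ).μ =
        -(gaussianPDFReal 0 1 0 * ((0 - a) ^ (2 * p + 1) * (tailFamily τ κ).w x 0)) := by
      rw [← this]
      change ∫ z in Set.Ici 0, _ ∂stdGauss = _
      congr 1; ext z; ring
    rw [e, neg_nonneg]
    refine mul_nonpos_of_nonneg_of_nonpos (gaussianPDFReal_nonneg _ _ _)
      (mul_nonpos_of_nonpos_of_nonneg ?_ ((tailFamily τ κ).w_pos x 0).le)
    exact (odd_two_mul_add_one p).pow_nonpos (by simp [ha])

variable {τ}

theorem abs_centralMoment_le (hτ : 0 ≤ τ) (x : ℝ) (S : Finset ℕ) (f : ℕ → ℕ) :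
    |(tailFamily τ κ).centralMoment S f x| ≤
      τ ^ S.card * (4 ^ S.card * (evenMoment S.card + 1)) := by
  refine ((tailFamily τ κ).abs_centralMoment_le (moments_le τ κ x) (L := fun _ => τ)
    fun i _ z => ?_).trans_eq (by rw [Finset.prod_const])
  have h0 := mul_nonneg hτ (abs_nonneg (z - max (τ * (x - κ)) 0))
  match f i with
  | 0 =>
    have e : (tailFamily τ κ).H 0 x z - (tailFamily τ κ).H 0 x (max (τ * (x - κ)) 0) =
        τ * (z - max (τ * (x - κ)) 0) := by simp only [tailFamily]; ring
    rw [e, abs_mul, abs_of_nonneg hτ]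
  | 1 => simpa [tailFamily] using h0
  | _ + 2 => simpa [tailFamily] using h0

end tailFamily

theorem exists_abs_iteratedDeriv_logTail_le {τ : ℝ} (hτ : 0 ≤ τ) {k : ℕ} (hk : 2 ≤ k) :
    ∃ A, ∀ κ, (∀ a ≤ k, Differentiable ℝ (iteratedDeriv a (logTail τ κ))) ∧
      ∀ x, |iteratedDeriv (k + 1) (logTail τ κ) x| ≤ A := by
  have hterm : ∀ n : ℕ, 0 ≤ τ ^ n * (4 ^ n * (evenMoment n + 1)) := fun n =>
    mul_nonneg (by positivity) (mul_nonneg (by positivity) (by linarith [evenMoment_nonneg n]))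
  obtain ⟨C, -, hmain⟩ := WeightFamily.exists_abs_iteratedDeriv_sub_mean_le k
    (Finset.sum_nonneg (s := Finset.range (k + 2)) fun n _ => hterm n)
  refine ⟨C * 1, fun κ => ?_⟩
  have hb : ∀ S f, momentOrder S f ≤ k + 1 → ∀ x, |(tailFamily τ κ).centralMoment S f x| ≤
      ∑ n ∈ Finset.range (k + 2), τ ^ n * (4 ^ n * (evenMoment n + 1)) := fun S f hS x =>
    (tailFamily.abs_centralMoment_le κ hτ x S f).trans (Finset.single_le_sum
      (f := fun n : ℕ => τ ^ n * (4 ^ n * (evenMoment n + 1))) (fun n _ => hterm n)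
      (Finset.mem_range.2 (Nat.lt_succ_of_le ((card_le_momentOrder S f).trans hS))))
  obtain ⟨h1, h2⟩ := hmain (tailFamily τ κ) 1 zero_le_one (by simp [tailFamily])
    (fun S f hS _ x => (hb S f hS x).trans_eq (mul_one _).symm)
    (fun S f hS _ x => hb S f hS.le x) _ (tailFamily.hasDerivAt_logTail τ κ)
  refine ⟨h1, fun x => ?_⟩
  have hm : (tailFamily τ κ).mean k x = 0 := by
    obtain ⟨j, rfl⟩ := Nat.exists_eq_add_of_le' hk
    exact (tailFamily τ κ).avg_const 0 x
  simpa only [hm, sub_zero] using h2 x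

theorem tameConcave_logTail {τ : ℝ} (hτ : 0 ≤ τ) (κ : ℝ) :
    TameConcave (τ ^ 2) (logTail τ κ) := by
  set T := tailFamily τ κ with hT
  have hd1 : deriv (logTail τ κ) = T.mean 0 :=
    funext fun x => (tailFamily.hasDerivAt_logTail τ κ x).deriv
  have hd2 : ∀ x, iteratedDeriv 2 (logTail τ κ) x = -τ ^ 2 + T.cov 0 x := fun x => by
    rw [iteratedDeriv_succ, iteratedDeriv_one, hd1, (T.hasDerivAt_mean 0 x).deriv]
    have h1 : T.mean 1 x = -τ ^ 2 := T.avg_const _ x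
    have h2 : T.m = 1 := rfl
    rw [h1, h2, one_mul]
  refine ⟨fun a => ?_, fun x => ?_, fun x => ?_, fun x => ?_, fun a ha => ?_⟩
  · obtain ⟨A, hA⟩ := exists_abs_iteratedDeriv_logTail_le hτ (k := a + 2) (by omega)
    exact (hA κ).1 a (by omega)
  · have : IsProbabilityMeasure stdGauss := by rw [stdGauss]; infer_instance
    exact Real.log_nonpos ENNReal.toReal_nonneg measureReal_le_one
  · rw [hd2]; linarith [T.cov_zero_nonneg x]
  · have h1 := T.cov_zero_eq_sub x (τ * (max (τ * (x - κ)) 0 - τ * (x - κ)))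
    have h2 : T.avg x (fun z => (T.H 0 x z - τ * (max (τ * (x - κ)) 0 - τ * (x - κ))) ^ 2) =
        τ ^ 2 * T.avg x (fun z => (z - max (τ * (x - κ)) 0) ^ (2 * 1)) := by
      rw [← T.avg_const_mul]
      congr 1; ext z
      simp only [hT, tailFamily]; ring
    have h3 : T.avg x (fun z => (z - max (τ * (x - κ)) 0) ^ (2 * 1)) ≤ 1 :=
      (tailFamily.moments_le τ κ x 1).trans_eq (by simp [evenMoment])
    have h4 := mul_le_mul_of_nonneg_left h3 (sq_nonneg τ)
    rw [hd2, h1, h2]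
    nlinarith [sq_nonneg (T.mean 0 x - τ * (max (τ * (x - κ)) 0 - τ * (x - κ)))]
  · obtain ⟨k, rfl⟩ : ∃ k, a = k + 1 := ⟨a - 1, by omega⟩
    obtain ⟨A, hA⟩ := exists_abs_iteratedDeriv_logTail_le hτ (k := k) (by omega)
    exact ⟨A, (hA κ).2⟩

namespace StepFn

variable (γ : StepFn)

theorem q_mono {i j : ℕ} (hij : i ≤ j) (hj : j ≤ γ.n + 1) : γ.q i ≤ γ.q j := by
  induction j, hij using Nat.le_induction with
  | base => exact le_rfl
  | succ j _ ih => exact (ih (by omega)).trans (γ.q_lt j (by omega)).le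

theorem m_le_m {i j : ℕ} (hij : i ≤ j) (hj : j ≤ γ.n) : γ.m i ≤ γ.m j := by
  induction j, hij using Nat.le_induction with
  | base => exact le_rfl
  | succ j _ ih => exact (ih (by omega)).trans (γ.m_mono j (by omega))

theorem m_nonneg {i : ℕ} (hi : i ≤ γ.n) : 0 ≤ γ.m i :=
  γ.m_zero.ge.trans (γ.m_le_m (Nat.zero_le i) hi)

theorem m_le_one {i : ℕ} (hi : i ≤ γ.n) : γ.m i ≤ 1 :=
  (γ.m_le_m hi le_rfl).trans γ.m_last.le

theorem q_nonneg {i : ℕ} (hi : i ≤ γ.n + 1) : 0 ≤ γ.q i :=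
  γ.q_zero.ge.trans (γ.q_mono (Nat.zero_le i) hi)

theorem q_le_one {i : ℕ} (hi : i ≤ γ.n + 1) : γ.q i ≤ 1 :=
  (γ.q_mono hi le_rfl).trans γ.q_last.le

/-- The reciprocal standard deviation of the terminal Gaussian tail. -/
noncomputable def slope : ℝ := (Real.sqrt (1 - γ.qbar))⁻¹

theorem slope_nonneg : 0 ≤ γ.slope := inv_nonneg.2 (Real.sqrt_nonneg _)

theorem PhiAux_zero_qbar (κ : ℝ) : γ.PhiAux κ 0 γ.qbar = logTail γ.slope κ := by
  ext x
  simp only [PhiAux, logTail, slope]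
  congr 2
  rw [div_eq_mul_inv]; ring

theorem tameConcave_PhiAux (κ : ℝ) {j : ℕ} (hj : j ≤ γ.n) :
    TameConcave (γ.slope ^ 2) (γ.PhiAux κ j (γ.q (γ.n - j))) := by
  induction j with
  | zero =>
    have := tameConcave_logTail γ.slope_nonneg κ
    rwa [← γ.PhiAux_zero_qbar κ] at this
  | succ j ih =>
    have e : γ.n - j = γ.n - (j + 1) + 1 := by omega
    refine (ih (by omega)).coleHopf (γ.m_nonneg (by omega)) (γ.m_le_one (by omega)) ?_ ?_
    · have := γ.q_lt (γ.n - (j + 1)) (by omega)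
      rw [e]; linarith
    · linarith [γ.q_le_one (i := γ.n - j) (by omega), γ.q_nonneg (i := γ.n - (j + 1)) (by omega)]

end StepFn

theorem one_add_le_mul_exp {A C s : ℝ} (hA : 0 ≤ 1 + A) :
    1 + (A + C * (s * (1 + A))) ≤ (1 + A) * Real.exp (C * s) := by
  have := mul_le_mul_of_nonneg_left (Real.add_one_le_exp (C * s)) hA
  linarith

theorem exists_abs_iteratedDeriv_PhiAux_le {τ : ℝ} (hτ : 0 ≤ τ) {k : ℕ} (hk : 2 ≤ k) :
    ∃ B, 1 ≤ B ∧ τ ^ 2 ≤ B ∧ ∀ (κ : ℝ) (γ : StepFn), γ.slope = τ → ∀ a, 3 ≤ a → a ≤ k →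
      ∀ j ≤ γ.n, ∀ x, |iteratedDeriv a (γ.PhiAux κ j (γ.q (γ.n - j))) x| ≤ B := by
  induction k, hk using Nat.le_induction with
  | base => exact ⟨1 + τ ^ 2, by linarith [sq_nonneg τ], by linarith, fun _ _ _ _ _ _ => by omega⟩
  | succ k hk ih =>
    obtain ⟨B, hB1, hBτ, hB⟩ := ih
    obtain ⟨A, hA⟩ := exists_abs_iteratedDeriv_logTail_le hτ hk
    obtain ⟨C, hC, hstep⟩ := TameConcave.exists_abs_iteratedDeriv_coleHopf_le hk hB1
    have hA0 : 0 ≤ A := (abs_nonneg _).trans ((hA 0).2 0)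
    refine ⟨max B ((1 + A) * Real.exp C), hB1.trans (le_max_left _ _), hBτ.trans (le_max_left _ _),
      fun κ γ hγ a ha hak j hj x => ?_⟩
    rcases Nat.lt_or_ge k a with hlt | hge
    · obtain rfl : a = k + 1 := by omega
      have hexp : ∀ j ≤ γ.n, ∀ x, |iteratedDeriv (k + 1) (γ.PhiAux κ j (γ.q (γ.n - j))) x| ≤
          (1 + A) * Real.exp (C * (γ.q γ.n - γ.q (γ.n - j))) - 1 := by
        intro j
        induction j with
        | zero =>
          intro _ x
          have := (hA κ).2 x
          rw [← hγ, ← γ.PhiAux_zero_qbar κ] at this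
          refine this.trans_eq ?_
          simp
        | succ j ihj =>
          intro hj x
          have h0 := γ.q_mono (i := γ.n - (j + 1)) (j := γ.n - j) (by omega) (by omega)
          have h1 := γ.q_le_one (i := γ.n - j) (by omega)
          have h2 := γ.q_nonneg (i := γ.n - (j + 1)) (by omega)
          have htame := γ.tameConcave_PhiAux κ (j := j) (by omega)
          rw [hγ] at htame
          have hA' := ihj (by omega)
          have h3 := (hstep _ _ htame hBτ (fun a ha hak x => hB κ γ hγ a ha hak j (by omega) x)
            (γ.m (γ.n - (j + 1))) (γ.q (γ.n - j) - γ.q (γ.n - (j + 1))) _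
            (γ.m_nonneg (by omega)) (γ.m_le_one (by omega)) (by linarith) (by linarith) hA').2 x
          have h4 := one_add_le_mul_exp (C := C) (s := γ.q (γ.n - j) - γ.q (γ.n - (j + 1)))
            (by linarith [(abs_nonneg _).trans (hA' 0)] :
              0 ≤ 1 + ((1 + A) * Real.exp (C * (γ.q γ.n - γ.q (γ.n - j))) - 1))
          have h5 : (1 + ((1 + A) * Real.exp (C * (γ.q γ.n - γ.q (γ.n - j))) - 1)) *
              Real.exp (C * (γ.q (γ.n - j) - γ.q (γ.n - (j + 1)))) =
              (1 + A) * Real.exp (C * (γ.q γ.n - γ.q (γ.n - (j + 1)))) := by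
            rw [add_sub_cancel, mul_assoc, ← Real.exp_add]
            congr 2; ring
          rw [h5] at h4
          refine h3.trans ?_
          linarith
      refine (hexp j hj x).trans (le_trans ?_ (le_max_right _ _))
      have h1 := γ.q_le_one (i := γ.n) (by omega)
      have h2 := γ.q_nonneg (i := γ.n - j) (by omega)
      have h3 : Real.exp (C * (γ.q γ.n - γ.q (γ.n - j))) ≤ Real.exp C :=
        Real.exp_le_exp.2 (mul_le_of_le_one_right hC (by linarith))
      nlinarith
    · exact (hB κ γ hγ a ha hge j hj x).trans (le_max_left _ _)

/-- Proposition 4.1, Eq. (4.10): for `γ ∈ SF⁺` with `q̄ = q̄(γ)` and every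
integer `k ≥ 3` there is a constant `C > 0` depending only on `q̄` and `k` such that
`|∂ₓᵏΦ_γ(t,x)| ≤ C` for all `(t,x) ∈ [0,q̄] × ℝ`, uniformly over `κ` and over all
`γ' ∈ SF⁺` with the same `q̄`. -/
theorem statement_4 (γ : StepFn) (k : ℕ) (hk : 3 ≤ k) :
    ∃ C > (0 : ℝ), ∀ (κ : ℝ) (γ' : StepFn), γ'.qbar = γ.qbar →
      ∀ t ∈ Set.Icc (0 : ℝ) γ.qbar, ∀ x : ℝ,
        |iteratedDeriv k (fun y => γ'.Phi κ t y) x| ≤ C := by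
  obtain ⟨l, rfl⟩ : ∃ l, k = l + 1 := ⟨k - 1, by omega⟩
  obtain ⟨B, hB1, hBτ, hB⟩ := exists_abs_iteratedDeriv_PhiAux_le γ.slope_nonneg
    (k := l + 1) (by omega)
  obtain ⟨C, hC, hstep⟩ := TameConcave.exists_abs_iteratedDeriv_coleHopf_le (k := l) (by omega) hB1
  refine ⟨B + C * (1 + B), by positivity, fun κ γ' hγ t ht x => ?_⟩
  have hslope : γ'.slope = γ.slope := by rw [StepFn.slope, StepFn.slope, hγ]
  have hBC : 0 ≤ C * (1 + B) := by positivity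
  classical
  set i := Nat.findGreatest (fun i => γ'.q i ≤ t) γ'.n with hi
  have hin : i ≤ γ'.n := Nat.findGreatest_le _
  have hqi : γ'.q i ≤ t := by
    have h0 : γ'.q 0 ≤ t := γ'.q_zero.le.trans ht.1
    exact Nat.findGreatest_spec (P := fun i => γ'.q i ≤ t) (Nat.zero_le _) h0
  have hPhi : (fun y => γ'.Phi κ t y) = γ'.PhiAux κ (γ'.n - i) t := by
    ext y; rw [StepFn.Phi, hi]
  rw [hPhi]
  rcases hin.eq_or_lt with heq | hlt
  · have hqt : γ'.qbar = t := by
      refine le_antisymm ?_ (hγ ▸ ht.2)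
      rw [StepFn.qbar, ← heq]; exact hqi
    have h1 := hB κ γ' hslope (l + 1) hk le_rfl 0 (Nat.zero_le _) x
    rw [heq, Nat.sub_self, ← hqt]
    exact h1.trans (by linarith)
  · obtain ⟨j, hj⟩ : ∃ j, γ'.n - i = j + 1 := ⟨γ'.n - i - 1, by omega⟩
    have hji : γ'.n - j = i + 1 := by omega
    have hti : t < γ'.q (i + 1) := not_le.1 fun h =>
      Nat.findGreatest_is_greatest (P := fun i => γ'.q i ≤ t) (k := i + 1) (n := γ'.n)
        (by rw [← hi]; omega) (by omega) h
    have h1 := γ'.q_le_one (i := i + 1) (by omega)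
    have htame := γ'.tameConcave_PhiAux κ (j := j) (by omega)
    rw [hslope] at htame
    have h2 := (hstep _ _ htame hBτ
      (fun a ha hak => hB κ γ' hslope a ha (by omega) j (by omega))
      (γ'.m (γ'.n - (j + 1))) (γ'.q (γ'.n - j) - t) B (γ'.m_nonneg (by omega))
      (γ'.m_le_one (by omega)) (by rw [hji]; linarith) (by rw [hji]; linarith [ht.1])
      (hB κ γ' hslope (l + 1) hk le_rfl j (by omega))).2 x
    rw [hj]
    refine h2.trans ?_
    have h3 : (γ'.q (γ'.n - j) - t) * (1 + B) ≤ 1 * (1 + B) := by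
      gcongr
      rw [hji]; linarith [ht.1]
    have h4 := mul_le_mul_of_nonneg_left h3 hC
    linarith
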